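/- arXiv:1101.1462 — 4 statements merged into one kernel-verified Lean document; each statement's English description precedes it below -/
import Mathlib

section
/- Suppose 0 ≤ k ≤ q and β > kn/q. Then the normalized instanton family is a minimizing sequence: lim_{ε→0⁺} I_{Ω;β,k}( u_ε / ‖u_ε‖_{L^q(Ω)} ) = S. In particular the same family simultaneously minimizes the unweighted Sobolev quotient and the weighted functional. -/
open MeasureTheory Filter Topology Set

noncomputable section

def smoothCpt (n : ℕ) (Ω : Set (EuclideanSpace ℝ (Fin n)))
    (u : EuclideanSpace ℝ (Fin n) → ℝ) : Prop :=
  ContDiff ℝ (⊤ : ℕ∞) u ∧ HasCompactSupport u ∧ tsupport u ⊆ Ω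

/-- The weighted energy `I_{Ω;β,k}(u) = ∫_Ω (1+|x|^β |u|^k) |∇u|²`. -/
def energy (n : ℕ) (Ω : Set (EuclideanSpace ℝ (Fin n))) (β k : ℝ)
    (u : EuclideanSpace ℝ (Fin n) → ℝ) : ℝ :=
  ∫ x in Ω, (1 + ‖x‖ ^ β * |u x| ^ k) * ‖gradient u x‖ ^ 2

/-- `S_Ω(β,k)`: infimum of the weighted energy over `C_c^∞(Ω)` functions normalized in `L^q`. -/
def Sw (n : ℕ) (Ω : Set (EuclideanSpace ℝ (Fin n))) (β k q : ℝ) : ℝ :=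
  sInf {c | ∃ u, smoothCpt n Ω u ∧ (∫ x in Ω, |u x| ^ q) = 1 ∧ c = energy n Ω β k u}

/-- The best Sobolev constant `S`. -/
def Sbest (n : ℕ) (Ω : Set (EuclideanSpace ℝ (Fin n))) (q : ℝ) : ℝ :=
  sInf {c | ∃ u, smoothCpt n Ω u ∧ (∫ x in Ω, |u x| ^ q) = 1 ∧
    c = ∫ x in Ω, ‖gradient u x‖ ^ 2}

open scoped ENNReal NNReal

/-- One-dimensional Brunn-Minkowski inequality. -/
theorem volume_add_volume_le_of_add_subset {A B C : Set ℝ} (hA : MeasurableSet A)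
    (hB : MeasurableSet B) (hA0 : A.Nonempty) (hB0 : B.Nonempty)
    (h : ∀ a ∈ A, ∀ b ∈ B, a + b ∈ C) : volume A + volume B ≤ volume C := by
  have compact_case : ∀ K L : Set ℝ, IsCompact K → IsCompact L → K.Nonempty → L.Nonempty →
      K ⊆ A → L ⊆ B → volume K + volume L ≤ volume C := by
    intro K L hK hL hK0 hL0 hKA hLB
    have ha := hK.sSup_mem hK0
    have hb := hL.sInf_mem hL0
    set a := sSup K
    set b := sInf L
    have h1 : volume ((fun x => x + b) '' K) = volume K := by
      rw [image_add_right, measure_preimage_add_right]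
    have h2 : volume ((fun x => a + x) '' L) = volume L := by
      rw [image_add_left, measure_preimage_add]
    have hmeas : MeasurableSet ((fun x => a + x) '' L) :=
      (hL.image (by fun_prop)).measurableSet
    have h3 := measure_union_add_inter (μ := volume) ((fun x => x + b) '' K) hmeas
    have h4 : volume ((fun x => x + b) '' K ∩ (fun x => a + x) '' L) = 0 := by
      refine measure_mono_null (t := {a + b}) ?_ (by simp)
      rintro _ ⟨⟨x, hx, rfl⟩, ⟨y, hy, hxy⟩⟩
      have := le_csSup hK.bddAbove hx
      have := csInf_le hL.bddBelow hy
      simp only [mem_singleton_iff] at *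
      linarith
    rw [h4, add_zero, h1, h2] at h3
    rw [← h3]
    refine measure_mono ?_
    rintro _ (⟨x, hx, rfl⟩ | ⟨y, hy, rfl⟩)
    · exact h _ (hKA hx) _ (hLB hb)
    · exact h _ (hKA ha) _ (hLB hy)
  obtain ⟨a₀, ha₀⟩ := hA0
  obtain ⟨b₀, hb₀⟩ := hB0
  refine le_of_forall_lt fun r hr => ?_
  by_cases hAz : volume A = 0
  · rw [hAz, zero_add] at hr
    obtain ⟨L, hLB, hL, hrL⟩ := hB.exists_lt_isCompact hr
    have hL0 : L.Nonempty := by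
      rcases L.eq_empty_or_nonempty with rfl | h
      · simp at hrL
      · exact h
    exact (hrL.trans_le le_add_self).trans_le (compact_case {a₀} L isCompact_singleton hL (by simp) hL0 (by simpa) hLB)
  by_cases hBz : volume B = 0
  · rw [hBz, add_zero] at hr
    obtain ⟨L, hLB, hL, hrL⟩ := hA.exists_lt_isCompact hr
    have hL0 : L.Nonempty := by
      rcases L.eq_empty_or_nonempty with rfl | h
      · simp at hrL
      · exact h
    exact (hrL.trans_le le_self_add).trans_le (compact_case L {b₀} hL isCompact_singleton hL0 (by simp) hLB (by simpa))
  obtain ⟨p, hp, q, hq, hpq⟩ := ENNReal.exists_lt_add_of_lt_add hr hAz hBz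
  obtain ⟨K, hKA, hK, hrK⟩ := hA.exists_lt_isCompact hp
  obtain ⟨L, hLB, hL, hrL⟩ := hB.exists_lt_isCompact hq
  have ne : ∀ (s : ℝ≥0∞) (L : Set ℝ), s < volume L → L.Nonempty := by
    intro s L hrL
    rcases L.eq_empty_or_nonempty with rfl | h
    · simp at hrL
    · exact h
  exact (hpq.trans_le (add_le_add hrK.le hrL.le)).trans_le
    (compact_case K L hK hL (ne _ _ hrK) (ne _ _ hrL) hKA hLB)

theorem lintegral_add_le_of_iSup_eq_one {u v w : ℝ → ℝ≥0∞} (hu : Measurable u)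
    (hv : Measurable v) (hw : Measurable w) (hu1 : ⨆ x, u x = 1) (hv1 : ⨆ x, v x = 1)
    (h : ∀ x y c, c < u x → c < v y → c ≤ w (x + y)) :
    (∫⁻ x, u x) + ∫⁻ x, v x ≤ ∫⁻ x, w x := by
  have layer : ∀ f : ℝ → ℝ≥0∞, Measurable f → (∀ x, f x ≤ 1) →
      ∫⁻ x, f x = ∫⁻ t in Ioi (0 : ℝ), volume {x | ENNReal.ofReal t < f x} := by
    intro f hf hf1
    have hft : ∀ x, f x ≠ ⊤ := fun x => ((hf1 x).trans_lt ENNReal.one_lt_top).ne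
    rw [← setLIntegral_congr_fun (f := fun t => volume {x | t < (f x).toReal}) measurableSet_Ioi,
      ← lintegral_eq_lintegral_meas_lt volume (Eventually.of_forall fun x => ENNReal.toReal_nonneg)
      hf.ennreal_toReal.aemeasurable]
    · exact lintegral_congr fun x => (ENNReal.ofReal_toReal (hft x)).symm
    · intro t ht
      simp only
      congr 1
      ext x
      exact (ENNReal.ofReal_lt_iff_lt_toReal (le_of_lt ht) (hft x)).symm
  have hu' : ∀ x, u x ≤ 1 := fun x => hu1 ▸ le_iSup u x
  have hv' : ∀ x, v x ≤ 1 := fun x => hv1 ▸ le_iSup v x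
  set w' : ℝ → ℝ≥0∞ := fun x => min (w x) 1 with hw'
  have hw'm : Measurable w' := hw.min measurable_const
  have hle : ∫⁻ x, w' x ≤ ∫⁻ x, w x := lintegral_mono fun x => min_le_left _ _
  refine le_trans ?_ hle
  rw [layer u hu hu', layer v hv hv', layer w' hw'm (fun x => min_le_right _ _)]
  refine (le_lintegral_add _ _).trans (lintegral_mono fun t => ?_)
  dsimp only
  rcases lt_or_ge (ENNReal.ofReal t) 1 with ht | ht
  · refine volume_add_volume_le_of_add_subset (measurableSet_lt measurable_const hu)
      (measurableSet_lt measurable_const hv) ?_ ?_ ?_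
    · rw [← hu1] at ht
      exact lt_iSup_iff.1 ht
    · rw [← hv1] at ht
      exact lt_iSup_iff.1 ht
    · intro a ha b hb
      obtain ⟨c, hc1, hc2⟩ := exists_between (lt_min (mem_ofPred.1 ha) (mem_ofPred.1 hb))
      refine lt_min (hc1.trans_le (h a b c (hc2.trans_le (min_le_left _ _))
        (hc2.trans_le (min_le_right _ _)))) ht
  · have e : ∀ f : ℝ → ℝ≥0∞, (∀ x, f x ≤ 1) → {x | ENNReal.ofReal t < f x} = ∅ := fun f hf => by
      ext x
      simpa using (hf x).trans ht
    rw [e u hu', e v hv']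
    simp

/-- `w (x + y)` dominates the `-1/j`-power sum of `u x` and `v y`, in a form which also makes
sense for `j = 0`, where it says `min (u x) (v y) ≤ w (x + y)`. -/
def PowerSumBound {X : Type*} [Add X] (j : ℕ) (u v w : X → ℝ≥0∞) : Prop :=
  ∀ (x y : X) (a b : ℝ≥0) (c : ℝ≥0∞), 0 < a → 0 < b → c < a ^ j * u x → c < b ^ j * v y →
    c ≤ (a + b) ^ j * w (x + y)

theorem NNReal.add_pow_div_le (j : ℕ) {a b α β : ℝ≥0} (ha : 0 < a) (hb : 0 < b) :
    (α + β) ^ (j + 1) / (a + b) ^ j ≤ α ^ (j + 1) / a ^ j + β ^ (j + 1) / b ^ j := by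
  have hab : 0 < a + b := by positivity
  have h := (convexOn_pow (𝕜 := ℝ) (j + 1)).2 (mem_Ici.2 (by positivity : (0 : ℝ) ≤ α / a))
    (mem_Ici.2 (by positivity : (0 : ℝ) ≤ β / b)) (by positivity : (0 : ℝ) ≤ a / (a + b))
    (by positivity : (0 : ℝ) ≤ b / (a + b))
    (by rw [← add_div]; exact div_self (by exact_mod_cast hab.ne'))
  have ha' : (0:ℝ) < a := ha
  have hb' : (0:ℝ) < b := hb
  have hab' : (0:ℝ) < a + b := hab
  simp only [smul_eq_mul] at h
  have e1 : (a / (a + b) * (α / a) + b / (a + b) * (β / b) : ℝ) = (α + β) / (a + b) := by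
    field_simp
  rw [e1] at h
  have h2 := mul_le_mul_of_nonneg_left h hab'.le
  have e2 : (a + b : ℝ) * ((α + β) / (a + b)) ^ (j + 1) = (α + β) ^ (j + 1) / (a + b) ^ j := by
    rw [div_pow, pow_succ (a + b : ℝ)]; field_simp
  have e3 : (a + b : ℝ) * (a / (a + b) * (α / a) ^ (j + 1) + b / (a + b) * (β / b) ^ (j + 1))
      = α ^ (j + 1) / a ^ j + β ^ (j + 1) / b ^ j := by
    rw [div_pow, div_pow, pow_succ (a : ℝ), pow_succ (b : ℝ)]; field_simp
  rw [e2, e3] at h2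
  exact_mod_cast h2

theorem PowerSumBound.lintegral_le_of_bdd {j : ℕ} {u v w : ℝ → ℝ≥0∞} (hu : Measurable u)
    (hv : Measurable v) (hw : Measurable w) (h : PowerSumBound (j + 1) u v w)
    {N : ℝ≥0} (huN : ∀ x, u x ≤ N) (hvN : ∀ x, v x ≤ N)
    {a b : ℝ≥0} {c : ℝ≥0∞} (ha : 0 < a) (hb : 0 < b)
    (hcu : c < a ^ j * ∫⁻ x, u x) (hcv : c < b ^ j * ∫⁻ x, v x) :
    c ≤ (a + b) ^ j * ∫⁻ x, w x := by
  have key : ∀ (u : ℝ → ℝ≥0∞) (a : ℝ≥0), Measurable u → (∀ x, u x ≤ N) → 0 < a →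
      c < a ^ j * ∫⁻ x, u x →
      ∃ α : ℝ≥0, 0 < α ∧ ⨆ x, (α : ℝ≥0∞) ^ (j + 1) * u x = 1 ∧
        c * ((α ^ (j + 1) / a ^ j : ℝ≥0) : ℝ≥0∞) ≤ ∫⁻ x, (α : ℝ≥0∞) ^ (j + 1) * u x := by
    intro u a hu huN ha hc
    have hA1 : (⨆ x, u x) ≠ ⊤ := ((iSup_le huN).trans_lt ENNReal.coe_lt_top).ne
    have hA0 : (⨆ x, u x) ≠ 0 := by
      intro h0
      have : ∀ x, u x = 0 := fun x => le_antisymm (h0 ▸ le_iSup u x) bot_le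
      simp [this] at hc
    obtain ⟨A, hA⟩ : ∃ A : ℝ≥0, (A : ℝ≥0∞) = ⨆ x, u x := ⟨_, ENNReal.coe_toNNReal hA1⟩
    rw [← hA] at hA0
    have hA0' : A ≠ 0 := by exact_mod_cast hA0
    set α : ℝ≥0 := (A⁻¹) ^ ((1:ℝ) / ((j + 1 : ℕ) : ℝ)) with hα
    have hαA : α ^ (j + 1) = A⁻¹ := by
      rw [hα, ← NNReal.rpow_natCast, ← NNReal.rpow_mul, one_div, inv_mul_cancel₀, NNReal.rpow_one]
      positivity
    refine ⟨α, ?_, ?_, ?_⟩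
    · exact NNReal.rpow_pos (inv_pos.2 (pos_iff_ne_zero.2 hA0'))
    · rw [← ENNReal.mul_iSup, ← hA, ← ENNReal.coe_pow, hαA, ← ENNReal.coe_mul,
        inv_mul_cancel₀ hA0', ENNReal.coe_one]
    · rw [lintegral_const_mul _ hu]
      calc c * ((α ^ (j + 1) / a ^ j : ℝ≥0) : ℝ≥0∞)
          ≤ (a ^ j * ∫⁻ x, u x) * ((α ^ (j + 1) / a ^ j : ℝ≥0) : ℝ≥0∞) := by gcongr
        _ = ((a ^ j * (α ^ (j + 1) / a ^ j) : ℝ≥0) : ℝ≥0∞) * ∫⁻ x, u x := by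
            push_cast; ring
        _ = _ := by
            rw [mul_div_cancel₀ _ (pow_ne_zero _ ha.ne')]; push_cast; rfl
  obtain ⟨α, hα, hα1, hα2⟩ := key u a hu huN ha hcu
  obtain ⟨β, hβ, hβ1, hβ2⟩ := key v b hv hvN hb hcv
  have h1 := lintegral_add_le_of_iSup_eq_one (hu.const_mul _) (hv.const_mul _)
    (hw.const_mul (((α + β : ℝ≥0∞)) ^ (j + 1))) hα1 hβ1
    (fun x y c hx hy => h x y α β c hα hβ hx hy)
  rw [lintegral_const_mul _ hw] at h1
  have h2 := (add_le_add hα2 hβ2).trans h1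
  rw [← mul_add, ← ENNReal.coe_add] at h2
  have h3 : c * (((α + β) ^ (j + 1) / (a + b) ^ j : ℝ≥0) : ℝ≥0∞) ≤ (α + β) ^ (j + 1) * ∫⁻ x, w x :=
    le_trans (by gcongr; exact NNReal.add_pow_div_le j ha hb) h2
  have hs : ((α + β : ℝ≥0∞)) ^ (j + 1) ≠ 0 := by
    rw [← ENNReal.coe_add, ← ENNReal.coe_pow]
    exact_mod_cast (by positivity : (0 : ℝ≥0) < (α + β) ^ (j + 1)).ne'
  have hs' : ((α + β : ℝ≥0∞)) ^ (j + 1) ≠ ⊤ := by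
    rw [← ENNReal.coe_add, ← ENNReal.coe_pow]
    exact ENNReal.coe_ne_top
  rw [← ENNReal.mul_le_mul_iff_right hs hs']
  calc ((α + β : ℝ≥0∞)) ^ (j + 1) * c
      = ((a + b) ^ j * ((α + β) ^ (j + 1) / (a + b) ^ j) : ℝ≥0) * c := by
        rw [mul_div_cancel₀ _ (pow_ne_zero _ (by positivity))]; push_cast; rfl
    _ = (a + b) ^ j * (c * (((α + β) ^ (j + 1) / (a + b) ^ j : ℝ≥0) : ℝ≥0∞)) := by
        push_cast; ring
    _ ≤ (a + b) ^ j * ((α + β) ^ (j + 1) * ∫⁻ x, w x) := by gcongr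
    _ = _ := by ring

theorem PowerSumBound.lintegral_le {j : ℕ} {u v w : ℝ → ℝ≥0∞} (hu : Measurable u)
    (hv : Measurable v) (hw : Measurable w) (h : PowerSumBound (j + 1) u v w)
    {a b : ℝ≥0} {c : ℝ≥0∞} (ha : 0 < a) (hb : 0 < b)
    (hcu : c < a ^ j * ∫⁻ x, u x) (hcv : c < b ^ j * ∫⁻ x, v x) :
    c ≤ (a + b) ^ j * ∫⁻ x, w x := by
  have trunc : ∀ (u : ℝ → ℝ≥0∞) (a : ℝ≥0), Measurable u → c < a ^ j * ∫⁻ x, u x →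
      ∃ N : ℕ, ∀ M ≥ N, c < a ^ j * ∫⁻ x, min (u x) (M : ℝ≥0) := by
    intro u a hu hc
    have e : ∫⁻ x, u x = ⨆ N : ℕ, ∫⁻ x, min (u x) ((N : ℝ≥0) : ℝ≥0∞) := by
      rw [← lintegral_iSup (fun N => hu.min measurable_const)]
      · refine lintegral_congr fun x => ?_
        change u x = ⨆ N : ℕ, u x ⊓ ((N : ℝ≥0) : ℝ≥0∞)
        rw [← inf_iSup_eq]
        simp [ENNReal.iSup_natCast]
      · intro N M hNM x
        dsimp only
        gcongr
    rw [e, ENNReal.mul_iSup] at hc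
    obtain ⟨N, hN⟩ := lt_iSup_iff.1 hc
    refine ⟨N, fun M hM => hN.trans_le ?_⟩
    gcongr
  obtain ⟨N₁, h₁⟩ := trunc u a hu hcu
  obtain ⟨N₂, h₂⟩ := trunc v b hv hcv
  refine PowerSumBound.lintegral_le_of_bdd (u := fun x => min (u x) ((max N₁ N₂ : ℕ) : ℝ≥0))
    (v := fun x => min (v x) ((max N₁ N₂ : ℕ) : ℝ≥0)) (N := (max N₁ N₂ : ℕ))
    (hu.min measurable_const) (hv.min measurable_const) hw ?_ (fun x => min_le_right _ _)
    (fun x => min_le_right _ _) ha hb (h₁ _ (le_max_left _ _)) (h₂ _ (le_max_right _ _))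
  intro x y a b c ha hb hx hy
  refine h x y a b c ha hb (hx.trans_le ?_) (hy.trans_le ?_) <;> gcongr <;> exact min_le_left _ _

theorem piFinSuccAbove_symm_eq_finCons {d : ℕ} (p : ℝ × (Fin d → ℝ)) :
    (MeasurableEquiv.piFinSuccAbove (fun _ : Fin (d + 1) => ℝ) 0).symm p = Fin.cons p.1 p.2 := by
  ext i
  refine Fin.cases ?_ (fun i => ?_) i <;> simp [MeasurableEquiv.piFinSuccAbove]

theorem lintegral_pi_succ {d : ℕ} (f : (Fin (d + 1) → ℝ) → ℝ≥0∞) (hf : Measurable f) :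
    ∫⁻ x, f x = ∫⁻ p : ℝ × (Fin d → ℝ), f (Fin.cons p.1 p.2) := by
  have h := (volume_preserving_piFinSuccAbove (fun _ : Fin (d + 1) => ℝ) 0).symm
  rw [← h.lintegral_comp hf]
  simp_rw [piFinSuccAbove_symm_eq_finCons]

theorem measurable_finCons {d : ℕ} :
    Measurable fun p : ℝ × (Fin d → ℝ) => (Fin.cons p.1 p.2 : Fin (d + 1) → ℝ) := by
  simp_rw [← piFinSuccAbove_symm_eq_finCons]
  exact (MeasurableEquiv.piFinSuccAbove (fun _ : Fin (d + 1) => ℝ) 0).symm.measurable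

theorem finCons_add {d : ℕ} (s t : ℝ) (x y : Fin d → ℝ) :
    (Fin.cons s x + Fin.cons t y : Fin (d + 1) → ℝ) = Fin.cons (s + t) (x + y) := by
  ext i
  refine Fin.cases ?_ (fun i => ?_) i <;> simp

/-- Borell-Brascamp-Lieb inequality with exponent `-1/d` in dimension `d`. -/
theorem PowerSumBound.le_lintegral_pi (d : ℕ) : ∀ {u v w : (Fin d → ℝ) → ℝ≥0∞}, Measurable u →
    Measurable v → Measurable w → PowerSumBound d u v w → ∀ {c : ℝ≥0∞}, c < ∫⁻ x, u x →
    c < ∫⁻ x, v x → c ≤ ∫⁻ x, w x := by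
  induction d with
  | zero =>
    intro u v w _ _ _ h c hcu hcv
    have e : ∀ f : (Fin 0 → ℝ) → ℝ≥0∞, ∫⁻ x, f x = f 0 := fun f => by
      rw [Measure.volume_pi_eq_dirac 0, lintegral_dirac]
    rw [e] at *
    simpa using h 0 0 1 1 c one_pos one_pos (by simpa using hcu) (by simpa using hcv)
  | succ d ih =>
    intro u v w hu hv hw h c hcu hcv
    have e : ∀ f : (Fin (d + 1) → ℝ) → ℝ≥0∞, Measurable f →
        ∫⁻ x, f x = ∫⁻ y : Fin d → ℝ, ∫⁻ t : ℝ, f (Fin.cons t y) := fun f hf => by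
      rw [lintegral_pi_succ f hf, Measure.volume_eq_prod]
      exact lintegral_prod_symm' _ (hf.comp measurable_finCons)
    have m1 : ∀ f : (Fin (d + 1) → ℝ) → ℝ≥0∞, Measurable f →
        Measurable fun y : Fin d → ℝ => ∫⁻ t : ℝ, f (Fin.cons t y) := fun f hf =>
      (hf.comp measurable_finCons).lintegral_prod_left'
    have m2 : ∀ f : (Fin (d + 1) → ℝ) → ℝ≥0∞, Measurable f → ∀ y : Fin d → ℝ,
        Measurable fun t : ℝ => f (Fin.cons t y) := fun f hf y =>
      (hf.comp measurable_finCons).comp (measurable_id.prodMk measurable_const)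
    rw [e u hu] at hcu
    rw [e v hv] at hcv
    rw [e w hw]
    refine ih (m1 u hu) (m1 v hv) (m1 w hw) ?_ hcu hcv
    intro x y a b c ha hb hx hy
    refine PowerSumBound.lintegral_le (m2 u hu x) (m2 v hv y) (m2 w hw (x + y)) ?_ ha hb hx hy
    intro s t a b c ha hb hs ht
    have := h _ _ a b c ha hb hs ht
    rwa [finCons_add] at this

/-- Integral of `f` over the hyperplane where the first coordinate equals `t`. -/
def sliceIntegral {d : ℕ} (f : EuclideanSpace ℝ (Fin (d + 1)) → ℝ≥0∞) (t : ℝ) : ℝ≥0∞ :=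
  ∫⁻ y : Fin d → ℝ, f (WithLp.toLp 2 (Fin.cons t y))

theorem measurable_toLp_finCons {d : ℕ} :
    Measurable fun p : ℝ × (Fin d → ℝ) =>
      (WithLp.toLp 2 (Fin.cons p.1 p.2) : EuclideanSpace ℝ (Fin (d + 1))) :=
  (PiLp.volume_preserving_toLp (Fin (d + 1))).measurable.comp measurable_finCons

theorem measurable_sliceIntegral {d : ℕ} {f : EuclideanSpace ℝ (Fin (d + 1)) → ℝ≥0∞}
    (hf : Measurable f) : Measurable (sliceIntegral f) :=
  (hf.comp measurable_toLp_finCons).lintegral_prod_right'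

theorem lintegral_sliceIntegral {d : ℕ} {f : EuclideanSpace ℝ (Fin (d + 1)) → ℝ≥0∞}
    (hf : Measurable f) : ∫⁻ t, sliceIntegral f t = ∫⁻ x, f x := by
  rw [← (PiLp.volume_preserving_toLp (Fin (d + 1))).lintegral_comp hf,
    lintegral_pi_succ (fun x => f (WithLp.toLp 2 x))
      (hf.comp (PiLp.volume_preserving_toLp (Fin (d + 1))).measurable), Measure.volume_eq_prod]
  exact (lintegral_prod _ (hf.comp measurable_toLp_finCons).aemeasurable).symm

/-- Borell-Brascamp-Lieb inequality with exponent `-1/d` in dimension `d + 1`, for two functions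
whose hyperplane integrals have the same supremum. -/
theorem PowerSumBound.lintegral_add_le {d : ℕ} {u v w : EuclideanSpace ℝ (Fin (d + 1)) → ℝ≥0∞}
    (hu : Measurable u) (hv : Measurable v) (hw : Measurable w) (h : PowerSumBound d u v w)
    (huv : ⨆ t, sliceIntegral u t = ⨆ t, sliceIntegral v t)
    (h0 : ⨆ t, sliceIntegral v t ≠ 0) (h1 : ⨆ t, sliceIntegral v t ≠ ⊤) :
    (∫⁻ x, u x) + ∫⁻ x, v x ≤ ∫⁻ x, w x := by
  set M := ⨆ t, sliceIntegral v t with hM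
  have hM1 : M⁻¹ * M = 1 := ENNReal.inv_mul_cancel h0 h1
  have hM0' : M⁻¹ ≠ 0 := ENNReal.inv_ne_zero.2 h1
  have hM1' : M⁻¹ ≠ ⊤ := ENNReal.inv_ne_top.2 h0
  have key := lintegral_add_le_of_iSup_eq_one ((measurable_sliceIntegral hu).const_mul M⁻¹)
    ((measurable_sliceIntegral hv).const_mul M⁻¹) ((measurable_sliceIntegral hw).const_mul M⁻¹)
    (by rw [← ENNReal.mul_iSup, huv, hM1]) (by rw [← ENNReal.mul_iSup, ← hM, hM1]) ?_
  · rw [lintegral_const_mul _ (measurable_sliceIntegral hu),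
      lintegral_const_mul _ (measurable_sliceIntegral hv),
      lintegral_const_mul _ (measurable_sliceIntegral hw), lintegral_sliceIntegral hu,
      lintegral_sliceIntegral hv, lintegral_sliceIntegral hw, ← mul_add] at key
    exact (ENNReal.mul_le_mul_iff_right hM0' hM1').1 key
  · intro s t c hs ht
    rw [mul_comm, ← div_eq_mul_inv, ENNReal.lt_div_iff_mul_lt (Or.inl h0) (Or.inl h1)] at hs ht
    rw [mul_comm, ← div_eq_mul_inv, ENNReal.le_div_iff_mul_le (Or.inl h0) (Or.inl h1)]
    have m2 : ∀ f : EuclideanSpace ℝ (Fin (d + 1)) → ℝ≥0∞, Measurable f → ∀ t : ℝ,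
        Measurable fun y : Fin d → ℝ => f (WithLp.toLp 2 (Fin.cons t y)) := fun f hf t =>
      (hf.comp measurable_toLp_finCons).comp (measurable_const.prodMk measurable_id)
    refine PowerSumBound.le_lintegral_pi d (m2 u hu s) (m2 v hv t) (m2 w hw (s + t)) ?_ hs ht
    intro x y a b c ha hb hx hy
    have := h _ _ a b c ha hb hx hy
    rwa [← WithLp.toLp_add, finCons_add] at this

theorem lintegral_comp_smul {E : Type*} [NormedAddCommGroup E] [NormedSpace ℝ E]
    [MeasurableSpace E] [BorelSpace E] [FiniteDimensional ℝ E] (μ : Measure E)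
    [μ.IsAddHaarMeasure] {f : E → ℝ≥0∞} (hf : Measurable f) {r : ℝ} (hr : r ≠ 0) :
    ∫⁻ x, f (r • x) ∂μ = ENNReal.ofReal |(r ^ Module.finrank ℝ E)⁻¹| * ∫⁻ x, f x ∂μ := by
  rw [← smul_eq_mul, ← lintegral_smul_measure, ← Measure.map_addHaar_smul μ hr,
    lintegral_map hf (by fun_prop)]

theorem powerSumBound_ofReal_inv_pow {X : Type*} [Add X] (d : ℕ) {φ ψ χ : X → ℝ}
    (hφ : ∀ x, 0 < φ x) (hψ : ∀ x, 0 < ψ x) (hχ : ∀ x, 0 < χ x)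
    (h : ∀ x y, χ (x + y) ≤ φ x + ψ y) :
    PowerSumBound d (fun x => ENNReal.ofReal ((φ x)⁻¹ ^ d))
      (fun x => ENNReal.ofReal ((ψ x)⁻¹ ^ d)) (fun x => ENNReal.ofReal ((χ x)⁻¹ ^ d)) := by
  intro x y a b c ha hb hx hy
  have e : ∀ (a : ℝ≥0) (r : ℝ), 0 < r →
      (a : ℝ≥0∞) ^ d * ENNReal.ofReal (r⁻¹ ^ d) = ENNReal.ofReal ((a / r) ^ d) := fun a r hr => by
    rw [← ENNReal.ofReal_coe_nnreal, ← ENNReal.ofReal_pow a.coe_nonneg, ← ENNReal.ofReal_mul (by positivity),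
      ← mul_pow, div_eq_mul_inv]
  rw [← ENNReal.coe_add]
  rw [e _ _ (hφ x)] at hx
  rw [e _ _ (hψ y)] at hy
  rw [e _ _ (hχ _), NNReal.coe_add]
  have ha' : (0 : ℝ) < a := ha
  have hb' : (0 : ℝ) < b := hb
  have h1 := hφ x
  have h2 := hψ y
  have h3 := hχ (x + y)
  have h4 := h x y
  rcases le_total ((a : ℝ) / φ x) (b / ψ y) with hab | hab
  · refine hx.le.trans (ENNReal.ofReal_le_ofReal ?_)
    gcongr ?_ ^ d
    rw [div_le_div_iff₀ h1 h3]
    rw [div_le_div_iff₀ h1 h2] at hab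
    nlinarith
  · refine hy.le.trans (ENNReal.ofReal_le_ofReal ?_)
    gcongr ?_ ^ d
    rw [div_le_div_iff₀ h2 h3]
    rw [div_le_div_iff₀ h2 h1] at hab
    nlinarith

theorem integrable_inv_one_add_norm_sq_pow {E : Type*} [NormedAddCommGroup E] [NormedSpace ℝ E]
    [MeasurableSpace E] [BorelSpace E] [FiniteDimensional ℝ E] (μ : Measure E)
    [μ.IsAddHaarMeasure] {m : ℕ} (hm : Module.finrank ℝ E < 2 * m) :
    Integrable (fun x : E => (1 + ‖x‖ ^ 2)⁻¹ ^ m) μ := by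
  have h := integrable_rpow_neg_one_add_norm_sq (E := E) (μ := μ) (r := (2 * m : ℕ))
    (by exact_mod_cast hm)
  refine h.congr (Eventually.of_forall fun x => ?_)
  dsimp only
  have : (0 : ℝ) ≤ 1 + ‖x‖ ^ 2 := by positivity
  rw [show (-((2 * m : ℕ) : ℝ) / 2) = -(m : ℝ) by push_cast; ring, Real.rpow_neg this,
    Real.rpow_natCast, inv_pow]

theorem norm_sq_le_norm_toLp_finCons_sq {d : ℕ} (t : ℝ) (y : Fin d → ℝ) :
    ‖y‖ ^ 2 ≤ ‖(WithLp.toLp 2 (Fin.cons t y) : EuclideanSpace ℝ (Fin (d + 1)))‖ ^ 2 := by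
  gcongr
  refine (pi_norm_le_iff_of_nonneg (norm_nonneg _)).2 fun i => ?_
  exact PiLp.norm_apply_le (WithLp.toLp 2 (Fin.cons t y) : EuclideanSpace ℝ (Fin (d + 1))) i.succ

theorem iSup_sliceIntegral_ne_top {d : ℕ} (hd : 1 ≤ d) {φ : EuclideanSpace ℝ (Fin (d + 1)) → ℝ}
    {c : ℝ} (hc : 0 < c) (h : ∀ x, c * (1 + ‖x‖ ^ 2) ≤ φ x) :
    ⨆ t, sliceIntegral (fun x => ENNReal.ofReal ((φ x)⁻¹ ^ d)) t ≠ ⊤ := by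
  have hdom := (integrable_inv_one_add_norm_sq_pow (E := Fin d → ℝ) volume (m := d)
    (by rw [Module.finrank_fin_fun]; omega)).const_mul (c⁻¹ ^ d)
  refine ((iSup_le fun t => ?_).trans_lt hdom.lintegral_lt_top).ne
  refine lintegral_mono fun y => ENNReal.ofReal_le_ofReal ?_
  dsimp only
  rw [← mul_pow, ← mul_inv]
  have h1 := h (WithLp.toLp 2 (Fin.cons t y))
  have h2 := norm_sq_le_norm_toLp_finCons_sq t y
  have h3 : c * (1 + ‖y‖ ^ 2) ≤ φ (WithLp.toLp 2 (Fin.cons t y)) := le_trans (by gcongr) h1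
  have h4 : 0 < c * (1 + ‖y‖ ^ 2) := by positivity
  exact pow_le_pow_left₀ (inv_nonneg.2 (h4.le.trans h3)) (inv_anti₀ h4 h3) d

theorem iSup_sliceIntegral_ne_zero {d : ℕ} {φ : EuclideanSpace ℝ (Fin (d + 1)) → ℝ}
    (hφ : Measurable φ) (h : ∀ x, 0 < φ x) :
    ⨆ t, sliceIntegral (fun x => ENNReal.ofReal ((φ x)⁻¹ ^ d)) t ≠ 0 := by
  intro h0
  have h1 : sliceIntegral (fun x => ENNReal.ofReal ((φ x)⁻¹ ^ d)) 0 = 0 :=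
    le_antisymm (h0 ▸ le_iSup (sliceIntegral (fun x => ENNReal.ofReal ((φ x)⁻¹ ^ d))) 0) bot_le
  rw [sliceIntegral, lintegral_eq_zero_iff] at h1
  · have : ∀ᵐ y : Fin d → ℝ, False := by
      filter_upwards [h1] with y hy
      have := h (WithLp.toLp 2 (Fin.cons 0 y))
      simp only [Pi.zero_apply, ENNReal.ofReal_eq_zero] at hy
      have : 0 < (φ (WithLp.toLp 2 (Fin.cons 0 y)))⁻¹ ^ d := by positivity
      linarith
    rw [eventually_false_iff_eq_bot, ae_eq_bot] at this
    exact NeZero.ne (volume : Measure (Fin d → ℝ)) this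
  · exact ((hφ.comp measurable_toLp_finCons).comp
      (measurable_const.prodMk measurable_id)).inv.pow_const d |>.ennreal_ofReal

theorem toLp_finCons_smul {d : ℕ} (r t : ℝ) (y : Fin d → ℝ) :
    (WithLp.toLp 2 (Fin.cons (r * t) (r • y)) : EuclideanSpace ℝ (Fin (d + 1))) =
      r • WithLp.toLp 2 (Fin.cons t y) := by
  ext i
  refine Fin.cases ?_ (fun i => ?_) i <;> simp

theorem iSup_sliceIntegral_dilate {d : ℕ} {ψ : EuclideanSpace ℝ (Fin (d + 1)) → ℝ}
    (hψ : Measurable ψ) {s : ℝ} (hs : 0 < s) :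
    ⨆ t, sliceIntegral (fun x => ENNReal.ofReal ((s * ψ (s⁻¹ • x))⁻¹ ^ d)) t =
      ⨆ t, sliceIntegral (fun x => ENNReal.ofReal ((ψ x)⁻¹ ^ d)) t := by
  have key : ∀ t, sliceIntegral (fun x => ENNReal.ofReal ((s * ψ (s⁻¹ • x))⁻¹ ^ d)) t =
      sliceIntegral (fun x => ENNReal.ofReal ((ψ x)⁻¹ ^ d)) (s⁻¹ * t) := by
    intro t
    have hm : Measurable fun y : Fin d → ℝ =>
        ENNReal.ofReal ((ψ (WithLp.toLp 2 (Fin.cons (s⁻¹ * t) y)))⁻¹ ^ d) :=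
      ((hψ.comp measurable_toLp_finCons).comp
        (measurable_const.prodMk measurable_id)).inv.pow_const d |>.ennreal_ofReal
    have h := lintegral_comp_smul volume hm (inv_ne_zero hs.ne')
    simp_rw [toLp_finCons_smul] at h
    rw [sliceIntegral, sliceIntegral]
    simp_rw [mul_inv, mul_pow, ENNReal.ofReal_mul (by positivity : (0 : ℝ) ≤ s⁻¹ ^ d)]
    rw [lintegral_const_mul' _ _ ENNReal.ofReal_ne_top, h, ← mul_assoc,
      ← ENNReal.ofReal_mul (by positivity), Module.finrank_fin_fun, abs_of_pos (by positivity),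
      mul_inv_cancel₀ (by positivity), ENNReal.ofReal_one, one_mul]
  simp_rw [key]
  exact (Equiv.mulLeft₀ s⁻¹ (inv_ne_zero hs.ne')).iSup_comp
    (g := fun t => sliceIntegral (fun x => ENNReal.ofReal ((ψ x)⁻¹ ^ d)) t)

theorem lintegral_dilate {d : ℕ} {ψ : EuclideanSpace ℝ (Fin (d + 1)) → ℝ}
    (hψ : Measurable ψ) {s : ℝ} (hs : 0 < s) :
    ∫⁻ x, ENNReal.ofReal ((s * ψ (s⁻¹ • x))⁻¹ ^ d) =
      ENNReal.ofReal s * ∫⁻ x, ENNReal.ofReal ((ψ x)⁻¹ ^ d) := by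
  have h := lintegral_comp_smul volume (f := fun x => ENNReal.ofReal ((ψ x)⁻¹ ^ d))
    (by fun_prop) (inv_ne_zero hs.ne')
  simp_rw [mul_inv, mul_pow, ENNReal.ofReal_mul (by positivity : (0 : ℝ) ≤ s⁻¹ ^ d)]
  rw [lintegral_const_mul' _ _ ENNReal.ofReal_ne_top, h, ← mul_assoc,
    ← ENNReal.ofReal_mul (by positivity), finrank_euclideanSpace_fin, abs_of_pos (by positivity)]
  congr 2
  rw [pow_succ]
  field_simp

theorem integrable_inv_pow_of_le {d : ℕ} (hd : 2 ≤ d) {φ : EuclideanSpace ℝ (Fin (d + 1)) → ℝ}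
    {c : ℝ} (hc : 0 < c) (hφ : Measurable φ) (h : ∀ x, c * (1 + ‖x‖ ^ 2) ≤ φ x) {m : ℕ}
    (hm : d ≤ m) : Integrable (fun x => (φ x)⁻¹ ^ m) := by
  have hdom := (integrable_inv_one_add_norm_sq_pow (E := EuclideanSpace ℝ (Fin (d + 1))) volume
    (m := m) (by rw [finrank_euclideanSpace_fin]; omega)).const_mul (c⁻¹ ^ m)
  refine hdom.mono' (by fun_prop) (Eventually.of_forall fun x => ?_)
  have h1 := h x
  have h2 : 0 < c * (1 + ‖x‖ ^ 2) := by positivity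
  rw [Real.norm_of_nonneg (by have := h2.trans_le h1; positivity), ← mul_pow, ← mul_inv]
  exact pow_le_pow_left₀ (inv_nonneg.2 (h2.le.trans h1)) (inv_anti₀ h2 h1) m

theorem integral_inv_pow_add_le {d : ℕ} (hd : 2 ≤ d)
    {φ χ : EuclideanSpace ℝ (Fin (d + 1)) → ℝ} {c c' s : ℝ} (hc : 0 < c) (hc' : 0 < c')
    (hs : 0 < s) (hφ : Measurable φ) (hχ : Measurable χ)
    (hφc : ∀ x, c * (1 + ‖x‖ ^ 2) ≤ φ x) (hχc : ∀ x, c' * (1 + ‖x‖ ^ 2) ≤ χ x)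
    (h : ∀ x y, χ (x + s • y) ≤ φ x + s * (1 + ‖y‖ ^ 2))
    (hsup : ⨆ t, sliceIntegral (fun x => ENNReal.ofReal ((φ x)⁻¹ ^ d)) t =
      ⨆ t, sliceIntegral (fun x : EuclideanSpace ℝ (Fin (d + 1)) =>
        ENNReal.ofReal ((1 + ‖x‖ ^ 2)⁻¹ ^ d)) t) :
    (∫ x, (φ x)⁻¹ ^ d) + s * ∫ x : EuclideanSpace ℝ (Fin (d + 1)), (1 + ‖x‖ ^ 2)⁻¹ ^ d ≤
      ∫ x, (χ x)⁻¹ ^ d := by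
  have hψ : Measurable fun x : EuclideanSpace ℝ (Fin (d + 1)) => 1 + ‖x‖ ^ 2 := by fun_prop
  have pos : ∀ {φ : EuclideanSpace ℝ (Fin (d + 1)) → ℝ} {c : ℝ}, 0 < c →
      (∀ x, c * (1 + ‖x‖ ^ 2) ≤ φ x) → ∀ x, 0 < φ x := fun hc h x =>
    lt_of_lt_of_le (by positivity) (h x)
  have hψ1 : ∀ x : EuclideanSpace ℝ (Fin (d + 1)), (1 : ℝ) * (1 + ‖x‖ ^ 2) ≤ 1 + ‖x‖ ^ 2 :=
    fun x => (one_mul _).le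
  have key := PowerSumBound.lintegral_add_le (d := d)
    (u := fun x => ENNReal.ofReal ((φ x)⁻¹ ^ d))
    (v := fun x => ENNReal.ofReal ((s * (1 + ‖s⁻¹ • x‖ ^ 2))⁻¹ ^ d))
    (w := fun x => ENNReal.ofReal ((χ x)⁻¹ ^ d)) (by fun_prop) (by fun_prop) (by fun_prop)
    (powerSumBound_ofReal_inv_pow d (pos hc hφc) (fun x => by positivity) (pos hc' hχc) ?_)
    (by rw [hsup, iSup_sliceIntegral_dilate hψ hs])
    (by rw [iSup_sliceIntegral_dilate hψ hs]
        exact iSup_sliceIntegral_ne_zero hψ (fun x => by positivity))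
    (by rw [iSup_sliceIntegral_dilate hψ hs]
        exact iSup_sliceIntegral_ne_top (by omega) one_pos hψ1)
  · rw [lintegral_dilate hψ hs] at key
    have conv : ∀ {φ : EuclideanSpace ℝ (Fin (d + 1)) → ℝ} {c : ℝ}, 0 < c → Measurable φ →
        (∀ x, c * (1 + ‖x‖ ^ 2) ≤ φ x) →
        ∫⁻ x, ENNReal.ofReal ((φ x)⁻¹ ^ d) = ENNReal.ofReal (∫ x, (φ x)⁻¹ ^ d) :=
      fun {φ c} hc hφ h => (ofReal_integral_eq_lintegral_ofReal
        (integrable_inv_pow_of_le hd hc hφ h le_rfl) (Eventually.of_forall fun x => by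
          have := pos hc h x
          positivity)).symm
    have nn : ∀ {φ : EuclideanSpace ℝ (Fin (d + 1)) → ℝ} {c : ℝ}, 0 < c →
        (∀ x, c * (1 + ‖x‖ ^ 2) ≤ φ x) → 0 ≤ ∫ x, (φ x)⁻¹ ^ d := fun {φ c} hc h =>
      integral_nonneg fun x => by
        have := pos hc h x
        positivity
    have n1 := nn hc hφc
    have n2 := nn one_pos hψ1
    rw [conv hc hφ hφc, conv hc' hχ hχc, conv one_pos hψ hψ1, ← ENNReal.ofReal_mul hs.le,
      ← ENNReal.ofReal_add n1 (by positivity), ENNReal.ofReal_le_ofReal_iff (nn hc' hχc)] at key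
    exact key
  · intro x y
    have := h x (s⁻¹ • y)
    rwa [smul_inv_smul₀ hs.ne'] at this

theorem exists_inv_one_add_pow_le (m : ℕ) : ∃ C : ℝ, 0 ≤ C ∧ ∀ τ : ℝ, |τ| ≤ 1 / 2 →
    (1 + τ)⁻¹ ^ m ≤ 1 - m * τ + C * τ ^ 2 := by
  induction m with
  | zero => exact ⟨0, le_rfl, fun τ _ => by simp⟩
  | succ m ih =>
    obtain ⟨C, hC, h⟩ := ih
    refine ⟨C + 2 + m + C + 2 * m + 2 * C, by positivity, fun τ hτ => ?_⟩
    have h1 := abs_le.1 hτ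
    have hpos : 0 < 1 + τ := by linarith
    have h2 : (1 + τ)⁻¹ ≤ 1 - τ + 2 * τ ^ 2 := by
      rw [inv_le_iff_one_le_mul₀ hpos]
      nlinarith [sq_nonneg τ]
    have h3 := h τ hτ
    have h4 : 0 ≤ (1 + τ)⁻¹ := by positivity
    have h5 : 0 ≤ (1 + τ)⁻¹ ^ m := by positivity
    rw [pow_succ]
    refine (mul_le_mul h3 h2 h4 (h5.trans h3)).trans ?_
    have hm : (0 : ℝ) ≤ m := by positivity
    push_cast
    have e : (1 - m * τ + C * τ ^ 2) * (1 - τ + 2 * τ ^ 2) = 1 - (m + 1) * τ +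
        (C + 2 + m) * τ ^ 2 + (C * τ ^ 2 * (-τ) + 2 * m * τ ^ 2 * (-τ) + 2 * C * τ ^ 2 * τ ^ 2) := by
      ring
    have k1 : C * τ ^ 2 * (-τ) ≤ C * τ ^ 2 * 1 := by gcongr; linarith
    have k2 : 2 * m * τ ^ 2 * (-τ) ≤ 2 * m * τ ^ 2 * 1 := by gcongr; linarith
    have k3 : 2 * C * τ ^ 2 * τ ^ 2 ≤ 2 * C * τ ^ 2 * 1 := by gcongr; nlinarith
    rw [e]
    nlinarith

theorem le_zero_of_forall_le_mul {X C s₀ : ℝ} (hs₀ : 0 < s₀)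
    (h : ∀ s, 0 < s → s ≤ s₀ → X ≤ s * C) : X ≤ 0 := by
  have ht : Tendsto (fun s : ℝ => s * C) (𝓝[>] 0) (𝓝 0) := by
    have : Tendsto (fun s : ℝ => s * C) (𝓝 0) (𝓝 (0 * C)) := tendsto_id.mul_const C
    rw [zero_mul] at this
    exact this.mono_left nhdsWithin_le_nhds
  refine ge_of_tendsto ht ?_
  filter_upwards [Ioc_mem_nhdsGT hs₀] with s hs
  exact h s hs.1 hs.2

theorem weighted_gradient_integral_ge {d : ℕ} (hd : 2 ≤ d)
    {φ : EuclideanSpace ℝ (Fin (d + 1)) → ℝ} {c M K : ℝ} (hc : 0 < c) (hK : 0 ≤ K)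
    (hφ : Differentiable ℝ φ) (hφc : ∀ x, c * (1 + ‖x‖ ^ 2) ≤ φ x)
    (hφM : ∀ x, ‖fderiv ℝ φ x‖ ^ 2 ≤ M * φ x)
    (hφK : ∀ x z, φ z + fderiv ℝ φ z (x - z) - K * ‖x - z‖ ^ 2 ≤ φ x)
    (hsup : ⨆ t, sliceIntegral (fun x => ENNReal.ofReal ((φ x)⁻¹ ^ d)) t =
      ⨆ t, sliceIntegral (fun x : EuclideanSpace ℝ (Fin (d + 1)) =>
        ENNReal.ofReal ((1 + ‖x‖ ^ 2)⁻¹ ^ d)) t) :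
    d * (∫ x, (φ x)⁻¹ ^ (d + 1)) +
        ∫ x : EuclideanSpace ℝ (Fin (d + 1)), (1 + ‖x‖ ^ 2)⁻¹ ^ d ≤
      d / 4 * ∫ x, (φ x)⁻¹ ^ (d + 1) * ‖fderiv ℝ φ x‖ ^ 2 := by
  have hm : Measurable φ := hφ.continuous.measurable
  have hm' : Measurable fun x => ‖fderiv ℝ φ x‖ := (measurable_fderiv ℝ φ).norm
  have pos : ∀ x, 0 < φ x := fun x => lt_of_lt_of_le (by positivity) (hφc x)
  have cle : ∀ x, c ≤ φ x := fun x => le_trans (by nlinarith [sq_nonneg ‖x‖]) (hφc x)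
  have hM : 0 ≤ M := nonneg_of_mul_nonneg_left ((sq_nonneg _).trans (hφM 0)) (pos 0)
  have iT := integrable_inv_pow_of_le hd hc hm hφc le_rfl
  have iP := integrable_inv_pow_of_le hd hc hm hφc (Nat.le_succ d)
  have iQ : Integrable (fun x => (φ x)⁻¹ ^ (d + 1) * ‖fderiv ℝ φ x‖ ^ 2) := by
    refine (iT.const_mul M).mono' (by fun_prop) (Eventually.of_forall fun x => ?_)
    have h1 := pos x
    rw [Real.norm_of_nonneg (by positivity)]
    calc (φ x)⁻¹ ^ (d + 1) * ‖fderiv ℝ φ x‖ ^ 2 ≤ (φ x)⁻¹ ^ (d + 1) * (M * φ x) := by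
          gcongr; exact hφM x
      _ = M * (φ x)⁻¹ ^ d := by rw [pow_succ]; field_simp
  obtain ⟨C, hC, hexp⟩ := exists_inv_one_add_pow_le d
  set R := c⁻¹ + M / 2 with hR
  have hR0 : 0 < R := by positivity
  set P := ∫ x, (φ x)⁻¹ ^ (d + 1) with hP
  set Q := ∫ x, (φ x)⁻¹ ^ (d + 1) * ‖fderiv ℝ φ x‖ ^ 2 with hQ
  set T := ∫ x, (φ x)⁻¹ ^ d with hT
  set Ψ := ∫ x : EuclideanSpace ℝ (Fin (d + 1)), (1 + ‖x‖ ^ 2)⁻¹ ^ d with hΨ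
  suffices h : d * P + Ψ - d / 4 * Q ≤ 0 by linarith
  refine le_zero_of_forall_le_mul (C := d * K / 2 * Q + C * R ^ 2 * T)
    (s₀ := min (1 / (2 * (K + 1))) (1 / (2 * R))) (by positivity) fun s hs hs0 => ?_
  have hs1 : s * (K + 1) ≤ 1 / 2 := by
    have := hs0.trans (min_le_left _ _)
    rw [le_div_iff₀ (by positivity)] at this
    linarith
  have hs2 : s * R ≤ 1 / 2 := by
    have := hs0.trans (min_le_right _ _)
    rw [le_div_iff₀ (by positivity)] at this
    linarith
  have hKs : K * s ≤ 1 / 2 := by nlinarith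
  have hKs1 : 0 < 1 - K * s := by linarith
  have hinv : (1 - K * s)⁻¹ ≤ 1 + 2 * (K * s) := by
    rw [inv_le_iff_one_le_mul₀ hKs1]
    have : 0 ≤ K * s := by positivity
    nlinarith
  have hinv2 : (1 - K * s)⁻¹ ≤ 2 := by linarith
  have hinv0 : 0 < (1 - K * s)⁻¹ := by positivity
  set τ : EuclideanSpace ℝ (Fin (d + 1)) → ℝ := fun x =>
    s * (1 - ‖fderiv ℝ φ x‖ ^ 2 * (1 - K * s)⁻¹ / 4) * (φ x)⁻¹ with hτ
  have τle : ∀ x, |τ x| ≤ s * R := by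
    intro x
    have h1 := pos x
    have hMx := hφM x
    have e1 : ‖fderiv ℝ φ x‖ ^ 2 * (φ x)⁻¹ ≤ M := by
      rw [← div_eq_mul_inv, div_le_iff₀ h1]; exact hMx
    have e2 : (φ x)⁻¹ ≤ c⁻¹ := inv_anti₀ hc (cle x)
    have e3 : 0 < (φ x)⁻¹ := by positivity
    have e4 : 0 ≤ ‖fderiv ℝ φ x‖ ^ 2 * (φ x)⁻¹ := by positivity
    have e5 : ‖fderiv ℝ φ x‖ ^ 2 * (φ x)⁻¹ * (1 - K * s)⁻¹ ≤ M * 2 := by gcongr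
    have e6 : 0 ≤ ‖fderiv ℝ φ x‖ ^ 2 * (φ x)⁻¹ * (1 - K * s)⁻¹ := by positivity
    have e7 : τ x = s * ((φ x)⁻¹ - ‖fderiv ℝ φ x‖ ^ 2 * (φ x)⁻¹ * (1 - K * s)⁻¹ / 4) := by
      simp only [hτ]; ring
    rw [e7, abs_mul, abs_of_pos hs]
    gcongr
    have hci : 0 < c⁻¹ := by positivity
    rw [abs_le]
    constructor <;> linarith
  have τhalf : ∀ x, |τ x| ≤ 1 / 2 := fun x => (τle x).trans hs2
  have hτm : Measurable τ := by
    have := hm'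
    fun_prop
  have key := integral_inv_pow_add_le (χ := fun x => φ x * (1 + τ x)) (c' := c / 2) hd hc
    (by positivity) hs hm (by fun_prop) hφc ?_ ?_ hsup
  · have hbound : ∀ x, (φ x * (1 + τ x))⁻¹ ^ d ≤ (φ x)⁻¹ ^ d - d * s * (φ x)⁻¹ ^ (d + 1) +
        (d * s / 4 + s ^ 2 * (d * K / 2)) * ((φ x)⁻¹ ^ (d + 1) * ‖fderiv ℝ φ x‖ ^ 2) +
        s ^ 2 * (C * R ^ 2) * (φ x)⁻¹ ^ d := by
      intro x
      have h1 := pos x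
      have h2 := hexp _ (τhalf x)
      have h3 : (τ x) ^ 2 ≤ (s * R) ^ 2 := by
        rw [← sq_abs]; gcongr; exact τle x
      have h4 : (1 + τ x)⁻¹ ^ d ≤ 1 - d * τ x + C * (s * R) ^ 2 :=
        h2.trans (by gcongr)
      have h5 : -τ x ≤ -(s * (φ x)⁻¹) +
          s * (‖fderiv ℝ φ x‖ ^ 2 * (1 + 2 * (K * s)) / 4) * (φ x)⁻¹ := by
        have : s * (‖fderiv ℝ φ x‖ ^ 2 * (1 - K * s)⁻¹ / 4) * (φ x)⁻¹ ≤
          s * (‖fderiv ℝ φ x‖ ^ 2 * (1 + 2 * (K * s)) / 4) * (φ x)⁻¹ := by gcongr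
        simp only [hτ]
        linarith
      have h6 : (d : ℝ) * -τ x ≤ d * (-(s * (φ x)⁻¹) +
          s * (‖fderiv ℝ φ x‖ ^ 2 * (1 + 2 * (K * s)) / 4) * (φ x)⁻¹) := by gcongr
      rw [mul_inv, mul_pow]
      calc (φ x)⁻¹ ^ d * (1 + τ x)⁻¹ ^ d ≤ (φ x)⁻¹ ^ d * (1 + d * (-(s * (φ x)⁻¹) +
          s * (‖fderiv ℝ φ x‖ ^ 2 * (1 + 2 * (K * s)) / 4) * (φ x)⁻¹) + C * (s * R) ^ 2) := by
            gcongr; linarith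
        _ = _ := by ring
    have hle := integral_mono_of_nonneg (μ := volume) (Eventually.of_forall fun x => ?_)
      (((iT.sub (iP.const_mul (d * s))).add
        (iQ.const_mul (d * s / 4 + s ^ 2 * (d * K / 2)))).add (iT.const_mul (s ^ 2 * (C * R ^ 2))))
      (Eventually.of_forall hbound)
    · simp only [Pi.add_apply, Pi.sub_apply] at hle
      rw [integral_add, integral_add, integral_sub, integral_const_mul, integral_const_mul,
        integral_const_mul] at hle
      · rw [← hP, ← hQ, ← hT] at hle
        have := key.trans hle
        have h2 : s * (d * P + Ψ - d / 4 * Q) ≤ s * (s * (d * K / 2 * Q + C * R ^ 2 * T)) := by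
          linarith
        exact le_of_mul_le_mul_left h2 hs
      · exact iT
      · exact iP.const_mul _
      · exact iT.sub (iP.const_mul _)
      · exact iQ.const_mul _
      · exact (iT.sub (iP.const_mul _)).add (iQ.const_mul _)
      · exact iT.const_mul _
    · have h1 := pos x
      have h2 := (abs_le.1 (τhalf x)).1
      have : 0 ≤ 1 + τ x := by linarith
      simp only [Pi.zero_apply]
      positivity
  · intro x
    have h2 := (abs_le.1 (τhalf x)).1
    have h1 := pos x
    have h3 := hφc x
    nlinarith
  · intro x y
    have h1 := pos (x + s • y)
    have h2 := hφK x (x + s • y)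
    have e : x - (x + s • y) = -(s • y) := by abel
    rw [e, norm_neg, norm_smul, map_neg, map_smul, Real.norm_of_nonneg hs.le, smul_eq_mul] at h2
    have h3 : fderiv ℝ φ (x + s • y) y ≤ ‖fderiv ℝ φ (x + s • y)‖ * ‖y‖ :=
      (le_abs_self _).trans ((fderiv ℝ φ (x + s • y)).le_opNorm y)
    set N := ‖fderiv ℝ φ (x + s • y)‖ with hN
    have h4 : N * ‖y‖ ≤ (1 - K * s) * ‖y‖ ^ 2 + N ^ 2 * (1 - K * s)⁻¹ / 4 := by
      have : 0 ≤ (1 - K * s) * (‖y‖ - N * (1 - K * s)⁻¹ / 2) ^ 2 := by positivity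
      have e : (1 - K * s) * (‖y‖ - N * (1 - K * s)⁻¹ / 2) ^ 2 =
          (1 - K * s) * ‖y‖ ^ 2 + N ^ 2 * (1 - K * s)⁻¹ / 4 - N * ‖y‖ := by
        field_simp; ring
      linarith
    have h5 : φ (x + s • y) * (1 + τ (x + s • y)) =
        φ (x + s • y) + s * (1 - N ^ 2 * (1 - K * s)⁻¹ / 4) := by
      simp only [hτ, ← hN]; field_simp
    rw [h5]
    have h6 : s * (fderiv ℝ φ (x + s • y) y) ≤
        s * ((1 - K * s) * ‖y‖ ^ 2 + N ^ 2 * (1 - K * s)⁻¹ / 4) := by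
      gcongr; exact h3.trans h4
    nlinarith

theorem integral_inv_one_add_norm_sq_pow_eq {d : ℕ} (hd : 2 ≤ d) :
    ((d : ℝ) - 1) * ∫ x : EuclideanSpace ℝ (Fin (d + 1)), (1 + ‖x‖ ^ 2)⁻¹ ^ d =
      2 * d * ∫ x : EuclideanSpace ℝ (Fin (d + 1)), (1 + ‖x‖ ^ 2)⁻¹ ^ (d + 1) := by
  set E := EuclideanSpace ℝ (Fin (d + 1))
  set Ψ := ∫ x : E, (1 + ‖x‖ ^ 2)⁻¹ ^ d with hΨ
  have iΨ : ∀ m, d ≤ m → Integrable (fun x : E => (1 + ‖x‖ ^ 2)⁻¹ ^ m) := fun m hm =>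
    integrable_inv_one_add_norm_sq_pow volume (by rw [finrank_euclideanSpace_fin]; omega)
  have hdiff := (hasDerivAt_integral_of_dominated_loc_of_deriv_le (μ := volume)
    (F := fun (l : ℝ) (x : E) => (l ^ 2 + ‖x‖ ^ 2)⁻¹ ^ d)
    (F' := fun (l : ℝ) (x : E) => -(2 * d * l * (l ^ 2 + ‖x‖ ^ 2)⁻¹ ^ (d + 1)))
    (x₀ := 1) (s := Metric.ball 1 (1 / 2))
    (bound := fun x => 2 * d * (3 / 2) * (4 ^ (d + 1) * (1 + ‖x‖ ^ 2)⁻¹ ^ (d + 1)))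
    (Metric.ball_mem_nhds 1 (by norm_num))
    (Eventually.of_forall fun l => by
      refine Measurable.aestronglyMeasurable ?_
      fun_prop) (by simpa using iΨ d le_rfl)
    (by refine Measurable.aestronglyMeasurable ?_
        fun_prop) ?_ (((iΨ (d + 1) (Nat.le_succ d)).const_mul _).const_mul _) ?_).2
  · have hscale : ∀ l : ℝ, 0 < l → ∫ x : E, (l ^ 2 + ‖x‖ ^ 2)⁻¹ ^ d = l⁻¹ ^ (d - 1) * Ψ := by
      intro l hl
      have h := Measure.integral_comp_smul volume (fun x : E => (l ^ 2 + ‖x‖ ^ 2)⁻¹ ^ d) l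
      have e : ∀ x : E, (l ^ 2 + ‖l • x‖ ^ 2)⁻¹ ^ d = (l⁻¹ ^ 2) ^ d * (1 + ‖x‖ ^ 2)⁻¹ ^ d := by
        intro x
        rw [norm_smul, Real.norm_of_nonneg hl.le, ← mul_pow]
        congr 1
        field_simp
      simp_rw [e] at h
      rw [integral_const_mul, ← hΨ, finrank_euclideanSpace_fin, smul_eq_mul,
        abs_of_pos (by positivity)] at h
      obtain ⟨k, rfl⟩ : ∃ k, d = k + 1 := ⟨d - 1, by omega⟩
      rw [Nat.add_sub_cancel]
      have h2 : ∫ x : E, (l ^ 2 + ‖x‖ ^ 2)⁻¹ ^ (k + 1) =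
          l ^ (k + 1 + 1) * ((l⁻¹ ^ 2) ^ (k + 1) * Ψ) := by
        rw [h]; field_simp
      rw [h2, inv_pow, inv_pow, inv_pow]
      field_simp
      ring
    have hd2 : HasDerivAt (fun l : ℝ => l⁻¹ ^ (d - 1) * Ψ)
        ((((d - 1 : ℕ) : ℝ) * (1 : ℝ)⁻¹ ^ (d - 1 - 1) * (-((1 : ℝ) ^ 2)⁻¹)) * Ψ) 1 :=
      ((hasDerivAt_inv one_ne_zero).pow (d - 1)).mul_const Ψ
    have hd3 := hd2.congr_of_eventuallyEq (f₁ := fun l : ℝ => ∫ x : E, (l ^ 2 + ‖x‖ ^ 2)⁻¹ ^ d)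
      (by filter_upwards [lt_mem_nhds one_pos] with l hl using hscale l hl)
    have := hdiff.unique hd3
    rw [integral_neg, integral_const_mul] at this
    simp only [mul_one, one_pow, inv_one, Nat.cast_sub (by omega : 1 ≤ d), Nat.cast_one] at this
    linarith
  · refine Eventually.of_forall fun x l hl => ?_
    rw [Metric.mem_ball, Real.dist_eq, abs_lt] at hl
    have hl0 : 0 < l := by linarith
    rw [norm_neg, Real.norm_of_nonneg (by positivity), ← mul_pow]
    have h4 : (l ^ 2 + ‖x‖ ^ 2)⁻¹ ≤ 4 * (1 + ‖x‖ ^ 2)⁻¹ := by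
      rw [inv_le_comm₀ (by positivity) (by positivity), mul_inv, inv_inv]
      nlinarith [sq_nonneg ‖x‖]
    gcongr
    linarith
  · refine Eventually.of_forall fun x l hl => ?_
    rw [Metric.mem_ball, Real.dist_eq, abs_lt] at hl
    have hl0 : 0 < l := by linarith
    have h1 : HasDerivAt (fun l : ℝ => l ^ 2 + ‖x‖ ^ 2) (2 * l) l := by
      simpa using (hasDerivAt_pow 2 l).add_const (‖x‖ ^ 2)
    have h2 := (h1.inv (by positivity)).pow d
    refine h2.congr_deriv ?_
    obtain ⟨k, rfl⟩ : ∃ k, d = k + 1 := ⟨d - 1, by omega⟩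
    rw [Nat.add_sub_cancel]
    have h3 : l ^ 2 + ‖x‖ ^ 2 ≠ 0 := by positivity
    simp only [Pi.inv_apply, inv_pow]
    field_simp
    ring

theorem weighted_gradient_integral_ge_rpow {d : ℕ} (hd : 2 ≤ d)
    {φ : EuclideanSpace ℝ (Fin (d + 1)) → ℝ} {c M K : ℝ} (hc : 0 < c) (hK : 0 ≤ K)
    (hφ : Differentiable ℝ φ) (hφc : ∀ x, c * (1 + ‖x‖ ^ 2) ≤ φ x)
    (hφM : ∀ x, ‖fderiv ℝ φ x‖ ^ 2 ≤ M * φ x)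
    (hφK : ∀ x z, φ z + fderiv ℝ φ z (x - z) - K * ‖x - z‖ ^ 2 ≤ φ x) :
    4 * (d + 1) / (d - 1) * ((∫ x, (φ x)⁻¹ ^ (d + 1)) ^ (((d : ℝ) - 1) / (d + 1)) *
        (∫ x : EuclideanSpace ℝ (Fin (d + 1)), (1 + ‖x‖ ^ 2)⁻¹ ^ (d + 1)) ^ (2 / ((d : ℝ) + 1))) ≤
      ∫ x, (φ x)⁻¹ ^ (d + 1) * ‖fderiv ℝ φ x‖ ^ 2 := by
  have hm : Measurable φ := hφ.continuous.measurable
  have pos : ∀ x, 0 < φ x := fun x => lt_of_lt_of_le (by positivity) (hφc x)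
  have hψm : Measurable fun x : EuclideanSpace ℝ (Fin (d + 1)) => 1 + ‖x‖ ^ 2 := by fun_prop
  have a0 := iSup_sliceIntegral_ne_zero hm pos
  have a1 := iSup_sliceIntegral_ne_top (by omega) hc hφc
  have b0 := iSup_sliceIntegral_ne_zero hψm (fun x => by positivity)
  have b1 := iSup_sliceIntegral_ne_top (d := d) (φ := fun x => 1 + ‖x‖ ^ 2) (by omega) one_pos
    (fun x => (one_mul _).le)
  set A := ⨆ t, sliceIntegral (fun x => ENNReal.ofReal ((φ x)⁻¹ ^ d)) t with hA
  set B := ⨆ t, sliceIntegral (fun x : EuclideanSpace ℝ (Fin (d + 1)) =>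
        ENNReal.ofReal ((1 + ‖x‖ ^ 2)⁻¹ ^ d)) t with hB
  have hr : 0 < A.toReal / B.toReal := div_pos (ENNReal.toReal_pos a0 a1) (ENNReal.toReal_pos b0 b1)
  set l : ℝ := (A.toReal / B.toReal) ^ ((d : ℝ)⁻¹) with hl
  have hl0 : 0 < l := Real.rpow_pos_of_pos hr _
  have hld : l ^ d = A.toReal / B.toReal := by
    rw [hl, ← Real.rpow_natCast, ← Real.rpow_mul hr.le, inv_mul_cancel₀, Real.rpow_one]
    positivity
  have hfd : ∀ x, fderiv ℝ (fun x => l * φ x) x = l • fderiv ℝ φ x := fun x =>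
    fderiv_const_mul (hφ x) l
  have key := weighted_gradient_integral_ge (φ := fun x => l * φ x) (c := l * c) (M := l * M)
    (K := l * K) hd (by positivity) (by positivity) (hφ.const_mul l)
    (fun x => by rw [mul_assoc]; gcongr; exact hφc x)
    (fun x => by
      rw [hfd, norm_smul, Real.norm_of_nonneg hl0.le]
      nlinarith [hφM x, mul_pos hl0 hl0])
    (fun x z => by
      rw [hfd]
      have := mul_le_mul_of_nonneg_left (hφK x z) hl0.le
      simp only [smul_apply, smul_eq_mul]
      linarith) ?_
  · simp_rw [hfd, norm_smul, Real.norm_of_nonneg hl0.le, mul_inv, mul_pow] at key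
    have e : ∀ x, l⁻¹ ^ (d + 1) * (φ x)⁻¹ ^ (d + 1) * (l ^ 2 * ‖fderiv ℝ φ x‖ ^ 2) =
        (l⁻¹ ^ (d + 1) * l ^ 2) * ((φ x)⁻¹ ^ (d + 1) * ‖fderiv ℝ φ x‖ ^ 2) := fun x => by ring
    simp_rw [e] at key
    rw [integral_const_mul, integral_const_mul] at key
    have hid := integral_inv_one_add_norm_sq_pow_eq hd
    have hP : 0 ≤ ∫ x, (φ x)⁻¹ ^ (d + 1) := integral_nonneg fun x => by
      have := pos x
      positivity
    have hb : 0 ≤ ∫ x : EuclideanSpace ℝ (Fin (d + 1)), (1 + ‖x‖ ^ 2)⁻¹ ^ (d + 1) :=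
      integral_nonneg fun x => by positivity
    set P := ∫ x, (φ x)⁻¹ ^ (d + 1)
    set Q := ∫ x, (φ x)⁻¹ ^ (d + 1) * ‖fderiv ℝ φ x‖ ^ 2
    set Ψ := ∫ x : EuclideanSpace ℝ (Fin (d + 1)), (1 + ‖x‖ ^ 2)⁻¹ ^ d
    set b := ∫ x : EuclideanSpace ℝ (Fin (d + 1)), (1 + ‖x‖ ^ 2)⁻¹ ^ (d + 1)
    have hd1 : (0 : ℝ) < d - 1 := by
      have : (2 : ℝ) ≤ d := by exact_mod_cast hd
      linarith
    have hd0 : (0 : ℝ) < d := by linarith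
    have hΨ : Ψ = 2 * d / (d - 1) * b := by field_simp; linarith
    have hQ : 4 * (l⁻¹ ^ 2 * P + 2 / (d - 1) * (l ^ (d - 1) * b)) ≤ Q := by
      have h1 : l ^ (d - 1) * (d * (l⁻¹ ^ (d + 1) * P) + Ψ) ≤
          l ^ (d - 1) * (d / 4 * (l⁻¹ ^ (d + 1) * l ^ 2 * Q)) := by gcongr
      obtain ⟨k, hk⟩ : ∃ k, d = k + 1 := ⟨d - 1, by omega⟩
      have e1 : l ^ (d - 1) * l⁻¹ ^ (d + 1) = l⁻¹ ^ 2 := by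
        rw [hk, Nat.add_sub_cancel, show k + 1 + 1 = k + 2 by ring, pow_add, ← mul_assoc,
          ← mul_pow, mul_inv_cancel₀ hl0.ne', one_pow, one_mul]
      have e2 : l⁻¹ ^ 2 * l ^ 2 = 1 := by rw [← mul_pow, inv_mul_cancel₀ hl0.ne', one_pow]
      have e3 : l ^ (d - 1) * (d * (l⁻¹ ^ (d + 1) * P) + Ψ) =
          d * ((l ^ (d - 1) * l⁻¹ ^ (d + 1)) * P) + l ^ (d - 1) * Ψ := by ring
      have e4 : l ^ (d - 1) * (d / 4 * (l⁻¹ ^ (d + 1) * l ^ 2 * Q)) =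
          d / 4 * ((l ^ (d - 1) * l⁻¹ ^ (d + 1)) * l ^ 2 * Q) := by ring
      rw [e3, e4, e1, e2, hΨ] at h1
      have h2 : d / 4 * (4 * (l⁻¹ ^ 2 * P + 2 / (d - 1) * (l ^ (d - 1) * b))) ≤ d / 4 * Q := by
        calc _ = d * (l⁻¹ ^ 2 * P) + l ^ (d - 1) * (2 * d / (d - 1) * b) := by
              field_simp
          _ ≤ _ := h1
          _ = _ := by ring
      exact le_of_mul_le_mul_left h2 (by positivity)
    have hamgm := Real.geom_mean_le_arith_mean2_weighted (w₁ := ((d : ℝ) - 1) / (d + 1))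
      (w₂ := 2 / ((d : ℝ) + 1)) (p₁ := l⁻¹ ^ 2 * P) (p₂ := l ^ (d - 1) * b) (by positivity)
      (by positivity) (by positivity) (by positivity) (by field_simp; ring)
    rw [Real.mul_rpow (by positivity) hP, Real.mul_rpow (by positivity) hb] at hamgm
    have e1 : (l⁻¹ ^ 2) ^ (((d : ℝ) - 1) / (d + 1)) * (l ^ (d - 1)) ^ (2 / ((d : ℝ) + 1)) = 1 := by
      rw [inv_pow, ← Real.rpow_natCast l 2, ← Real.rpow_natCast l (d - 1), ← Real.rpow_neg hl0.le,
        ← Real.rpow_mul hl0.le, ← Real.rpow_mul hl0.le, ← Real.rpow_add hl0,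
        Nat.cast_sub (by omega)]
      convert Real.rpow_zero l using 2
      push_cast
      ring
    have e2 : (l⁻¹ ^ 2) ^ (((d : ℝ) - 1) / (d + 1)) * P ^ (((d : ℝ) - 1) / (d + 1)) *
        ((l ^ (d - 1)) ^ (2 / ((d : ℝ) + 1)) * b ^ (2 / ((d : ℝ) + 1))) =
        P ^ (((d : ℝ) - 1) / (d + 1)) * b ^ (2 / ((d : ℝ) + 1)) := by
      rw [mul_mul_mul_comm, e1, one_mul]
    rw [e2] at hamgm
    refine le_trans ?_ hQ
    calc _ ≤ 4 * (d + 1) / (d - 1) * (((d : ℝ) - 1) / (d + 1) * (l⁻¹ ^ 2 * P) +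
          2 / (d + 1) * (l ^ (d - 1) * b)) := by gcongr
      _ = _ := by field_simp
  · rw [← hB]
    have h1 : ∀ t, sliceIntegral (fun x => ENNReal.ofReal ((l * φ x)⁻¹ ^ d)) t =
        ENNReal.ofReal (l⁻¹ ^ d) * sliceIntegral (fun x => ENNReal.ofReal ((φ x)⁻¹ ^ d)) t := by
      intro t
      rw [sliceIntegral, sliceIntegral, ← lintegral_const_mul' _ _ ENNReal.ofReal_ne_top]
      refine lintegral_congr fun y => ?_
      rw [← ENNReal.ofReal_mul (by positivity), mul_inv, mul_pow]
    simp_rw [h1]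
    rw [← ENNReal.mul_iSup, ← hA, inv_pow, hld, inv_div,
      ENNReal.ofReal_div_of_pos (ENNReal.toReal_pos a0 a1), ENNReal.ofReal_toReal a1,
      ENNReal.ofReal_toReal b1, ENNReal.div_mul_cancel a0 a1]

section InnerProductSpace

variable {E : Type*} [NormedAddCommGroup E] [InnerProductSpace ℝ E]

theorem hasFDerivAt_const_add_norm_sq (c : ℝ) (x : E) :
    HasFDerivAt (fun x : E => c + ‖x‖ ^ 2) ((2 : ℝ) • innerSL ℝ x) x := by
  have h := (hasStrictFDerivAt_norm_sq x).hasFDerivAt.const_add c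
  rwa [two_smul, ← two_smul ℝ (innerSL ℝ x)] at h

theorem norm_two_smul_innerSL (x : E) : ‖(2 : ℝ) • innerSL ℝ x‖ = 2 * ‖x‖ := by
  rw [norm_smul, innerSL_apply_norm, Real.norm_of_nonneg zero_le_two]

theorem hasFDerivAt_inv_one_add_norm_sq_pow (m : ℕ) (x : E) :
    HasFDerivAt (fun x : E => (1 + ‖x‖ ^ 2)⁻¹ ^ m)
      ((-((m : ℝ) * (1 + ‖x‖ ^ 2)⁻¹ ^ (m + 1))) • ((2 : ℝ) • innerSL ℝ x)) x := by
  have h0 : 1 + ‖x‖ ^ 2 ≠ 0 := by positivity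
  have h1 : HasDerivAt (fun t : ℝ => t⁻¹ ^ m) (-(m * (1 + ‖x‖ ^ 2)⁻¹ ^ (m + 1)))
      (1 + ‖x‖ ^ 2) := by
    refine ((hasDerivAt_inv h0).pow m).congr_deriv ?_
    rcases m with _ | k
    · simp
    · rw [Nat.add_sub_cancel]
      simp only [inv_pow]
      field_simp
      ring
  exact HasDerivAt.comp_hasFDerivAt (h₂ := fun t : ℝ => t⁻¹ ^ m) x h1 (hasFDerivAt_const_add_norm_sq 1 x)

end InnerProductSpace

theorem exists_quadratic_lower_bound {E : Type*} [NormedAddCommGroup E] [NormedSpace ℝ E]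
    {χ : E → ℝ} (hχ : ContDiff ℝ 2 χ) (hc : HasCompactSupport χ) :
    ∃ K : ℝ, 0 ≤ K ∧ ∀ x z, χ z + fderiv ℝ χ z (x - z) - K * ‖x - z‖ ^ 2 ≤ χ x := by
  obtain ⟨K, hK⟩ := ContDiff.lipschitzWith_of_hasCompactSupport (𝕂 := ℝ) (n := 1) (hc.fderiv ℝ)
    (hχ.fderiv_right (by norm_num)) one_ne_zero
  refine ⟨K, K.2, fun x z => ?_⟩
  have h := (convex_segment z x).norm_image_sub_le_of_norm_fderiv_le' (𝕜 := ℝ) (f := χ)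
    (C := K * ‖x - z‖) (φ := fderiv ℝ χ z)
    (fun y _ => (hχ.differentiable (by norm_num)) y) (fun y hy => ?_)
    (left_mem_segment ℝ z x) (right_mem_segment ℝ z x)
  · have := (abs_le.1 h).1
    nlinarith
  · refine (hK.norm_sub_le y z).trans ?_
    gcongr
    rw [segment_eq_image'] at hy
    obtain ⟨t, ht, rfl⟩ := hy
    rw [add_sub_cancel_left, norm_smul, Real.norm_of_nonneg ht.1]
    exact mul_le_of_le_one_left (norm_nonneg _) ht.2

theorem norm_two_mul_smul_add_smul_sq_le {F : Type*} [NormedAddCommGroup F] [NormedSpace ℝ F]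
    {a b : F} {u D W v : ℝ} (hD : 0 ≤ D) (hW : 0 ≤ W) (hv : 0 ≤ v) (hb : ‖b‖ ^ 2 ≤ 4 * W * v) :
    ‖(2 * u) • a + D • b‖ ^ 2 ≤ 4 * (u ^ 2 + D * W) * (‖a‖ ^ 2 + D * v) := by
  have h1 : ‖(2 * u) • a + D • b‖ ≤ 2 * |u| * ‖a‖ + D * (2 * (√W * √v)) := by
    refine (norm_add_le _ _).trans ?_
    rw [norm_smul, norm_smul, Real.norm_eq_abs, abs_mul, abs_two, Real.norm_of_nonneg hD]
    gcongr
    refine abs_le_of_sq_le_sq' ?_ (by positivity) |>.2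
    rw [mul_pow, mul_pow, Real.sq_sqrt hW, Real.sq_sqrt hv]
    linarith
  have h2 := Real.sq_sqrt hW
  have h3 := Real.sq_sqrt hv
  have h4 := sq_abs u
  calc _ ≤ (2 * |u| * ‖a‖ + D * (2 * (√W * √v))) ^ 2 := by gcongr
    _ = 4 * (|u| ^ 2 + D * √W ^ 2) * (‖a‖ ^ 2 + D * √v ^ 2) -
        4 * D * (|u| * √v - √W * ‖a‖) ^ 2 := by ring
    _ ≤ _ := by
      rw [h2, h3, h4]
      have : 0 ≤ 4 * D * (|u| * √v - √W * ‖a‖) ^ 2 := by positivity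
      linarith

theorem sobolev_integral_ge_of_pos {d : ℕ} (hd : 2 ≤ d)
    {u : EuclideanSpace ℝ (Fin (d + 1)) → ℝ} (hu : ContDiff ℝ (⊤ : ℕ∞) u)
    (hc : HasCompactSupport u)
    (hu1 : ∫ x, |u x| ^ (2 * ((d : ℝ) + 1) / (d - 1)) = 1) {D : ℝ} (hD : 0 < D) :
    ((d : ℝ) + 1) * (d - 1) *
        (∫ x : EuclideanSpace ℝ (Fin (d + 1)), (1 + ‖x‖ ^ 2)⁻¹ ^ (d + 1)) ^ (2 / ((d : ℝ) + 1)) ≤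
      (∫ x, ‖fderiv ℝ u x‖ ^ 2) +
        D * (((d : ℝ) - 1) ^ 2 * ∫ x : EuclideanSpace ℝ (Fin (d + 1)), (1 + ‖x‖ ^ 2)⁻¹ ^ d) := by
  have hd1 : (0 : ℝ) < d - 1 := by
    have : (2 : ℝ) ≤ d := by exact_mod_cast hd
    linarith
  have hdc : ((d - 1 : ℕ) : ℝ) = d - 1 := by rw [Nat.cast_sub (by omega), Nat.cast_one]
  set s : ℝ := -1 / (d - 1) with hs
  have hs0 : s < 0 := div_neg_of_neg_of_pos (by norm_num) hd1
  have hsd : s * (d - 1) = -1 := by rw [hs]; field_simp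
  set W : EuclideanSpace ℝ (Fin (d + 1)) → ℝ := fun x => (1 + ‖x‖ ^ 2)⁻¹ ^ (d - 1) with hW
  have hWpos : ∀ x, 0 < W x := fun x => by positivity
  have hψ : ContDiff ℝ (⊤ : ℕ∞) fun x : EuclideanSpace ℝ (Fin (d + 1)) => 1 + ‖x‖ ^ 2 := contDiff_const.add (contDiff_norm_sq ℝ)
  have hWs : ContDiff ℝ (⊤ : ℕ∞) W := (hψ.inv fun x => by positivity).pow _
  have hWr : ∀ (a : ℝ), 0 < a → ∀ x, (a * W x) ^ s = a ^ s * (1 + ‖x‖ ^ 2) := by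
    intro a ha x
    rw [Real.mul_rpow ha.le (hWpos x).le]
    congr 1
    rw [hW]
    simp only
    rw [← Real.rpow_natCast, hdc, Real.inv_rpow (by positivity), ← Real.rpow_neg (by positivity),
      ← Real.rpow_mul (by positivity), show -((d : ℝ) - 1) * s = 1 by linarith, Real.rpow_one]
  set g : EuclideanSpace ℝ (Fin (d + 1)) → ℝ := fun x => u x ^ 2 + D * W x with hg
  have hgpos : ∀ x, 0 < g x := fun x => by
    have := hWpos x
    positivity
  have hgs : ContDiff ℝ (⊤ : ℕ∞) g := (hu.pow 2).add (contDiff_const.mul hWs)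
  set φ : EuclideanSpace ℝ (Fin (d + 1)) → ℝ := fun x => g x ^ s with hφ
  have hφs : ContDiff ℝ (⊤ : ℕ∞) φ := hgs.rpow_const_of_ne fun x => (hgpos x).ne'
  have hφpos : ∀ x, 0 < φ x := fun x => Real.rpow_pos_of_pos (hgpos x) _
  set κ : ℝ := D ^ s with hκ
  have hκ0 : 0 < κ := Real.rpow_pos_of_pos hD _
  set χ : EuclideanSpace ℝ (Fin (d + 1)) → ℝ := fun x => φ x - κ * (1 + ‖x‖ ^ 2) with hχ
  have hχs : ContDiff ℝ (⊤ : ℕ∞) χ := hφs.sub (contDiff_const.mul hψ)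
  have hχc : HasCompactSupport χ := HasCompactSupport.intro hc fun x hx => by
    simp only [hχ, hφ, hg]
    rw [image_eq_zero_of_notMem_tsupport hx, zero_pow two_ne_zero, zero_add, hWr D hD, sub_self]
  have hχd : ∀ x, fderiv ℝ φ x = fderiv ℝ χ x + κ • ((2 : ℝ) • innerSL ℝ x) := by
    intro x
    have h1 := ((hχs.differentiable (by simp)) x).hasFDerivAt.add
      ((hasFDerivAt_const_add_norm_sq 1 x).const_mul κ)
    refine (h1.congr_of_eventuallyEq (Eventually.of_forall fun y => ?_)).fderiv
    simp [hχ]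
  obtain ⟨C, hC⟩ := (((hu.pow 2).mul (hψ.pow (d - 1))).continuous).bounded_above_of_compact_support
    (f := fun x => u x ^ 2 * (1 + ‖x‖ ^ 2) ^ (d - 1))
    (HasCompactSupport.intro hc fun x hx => by
      simp [image_eq_zero_of_notMem_tsupport hx])
  have hC0 : 0 ≤ C := (norm_nonneg _).trans (hC 0)
  set c : ℝ := (C + D) ^ s with hcdef
  have hc0 : 0 < c := Real.rpow_pos_of_pos (by positivity) _
  have hφc : ∀ x, c * (1 + ‖x‖ ^ 2) ≤ φ x := by
    intro x
    rw [hcdef, ← hWr (C + D) (by positivity) x]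
    refine Real.rpow_le_rpow_of_nonpos (hgpos x) ?_ hs0.le
    have h1 := (le_abs_self _).trans (hC x)
    have h2 : u x ^ 2 ≤ C * W x := by
      rw [hW]
      simp only [inv_pow]
      rwa [← div_eq_mul_inv, le_div_iff₀ (by positivity)]
    simp only [hg]
    linarith
  obtain ⟨L, hL⟩ := (hχs.continuous_fderiv (by simp)).bounded_above_of_compact_support
    (hχc.fderiv ℝ)
  have hL0 : 0 ≤ L := (norm_nonneg _).trans (hL 0)
  have hφM : ∀ x, ‖fderiv ℝ φ x‖ ^ 2 ≤ ((8 * κ ^ 2 + 2 * L ^ 2) / c) * φ x := by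
    intro x
    have h1 : ‖fderiv ℝ φ x‖ ≤ L + κ * (2 * ‖x‖) := by
      rw [hχd]
      refine (norm_add_le _ _).trans ?_
      rw [norm_smul, norm_two_smul_innerSL, Real.norm_of_nonneg hκ0.le]
      gcongr
      exact hL x
    calc _ ≤ (L + κ * (2 * ‖x‖)) ^ 2 := by gcongr
      _ ≤ (8 * κ ^ 2 + 2 * L ^ 2) / c * (c * (1 + ‖x‖ ^ 2)) := by
        field_simp
        nlinarith [sq_nonneg (L - 2 * κ * ‖x‖), mul_nonneg (sq_nonneg L) (sq_nonneg ‖x‖),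
          sq_nonneg κ]
      _ ≤ _ := by gcongr; exact hφc x
  obtain ⟨K, hK0, hK⟩ := exists_quadratic_lower_bound (mod_cast contDiff_infty.1 hχs 2) hχc
  have hφK : ∀ x z, φ z + fderiv ℝ φ z (x - z) - K * ‖x - z‖ ^ 2 ≤ φ x := by
    intro x z
    have h1 := hK x z
    have h2 : ‖x‖ ^ 2 = ‖z‖ ^ 2 + 2 * inner ℝ z (x - z) + ‖x - z‖ ^ 2 := by
      rw [← norm_add_sq_real, add_sub_cancel]
    have h3 : φ x = χ x + κ * (1 + ‖x‖ ^ 2) := by simp [hχ]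
    have h4 : φ z = χ z + κ * (1 + ‖z‖ ^ 2) := by simp [hχ]
    rw [hχd, h3, h4, h2, add_apply, smul_apply, smul_apply, innerSL_apply_apply, smul_eq_mul,
      smul_eq_mul]
    nlinarith [mul_nonneg hκ0.le (sq_nonneg ‖x - z‖)]
  have key := weighted_gradient_integral_ge_rpow hd hc0 hK0 (hφs.differentiable (by simp)) hφc hφM
    hφK
  set b := ∫ x : EuclideanSpace ℝ (Fin (d + 1)), (1 + ‖x‖ ^ 2)⁻¹ ^ (d + 1)
  have hb : 0 ≤ b := integral_nonneg fun x => by positivity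
  have hφg : ∀ x, (φ x)⁻¹ ^ (d + 1) = g x ^ (((d : ℝ) + 1) / (d - 1)) := by
    intro x
    rw [hφ]
    simp only
    rw [← Real.rpow_neg (hgpos x).le, ← Real.rpow_natCast, ← Real.rpow_mul (hgpos x).le, hs]
    congr 1
    push_cast
    field_simp
  have hP : 1 ≤ ∫ x, (φ x)⁻¹ ^ (d + 1) := by
    rw [← hu1]
    refine integral_mono_of_nonneg (Eventually.of_forall fun x => by positivity)
      (integrable_inv_pow_of_le hd hc0 hφs.continuous.measurable hφc (Nat.le_succ d))
      (Eventually.of_forall fun x => ?_)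
    simp only
    rw [hφg, mul_div_assoc, Real.rpow_mul (abs_nonneg _), Real.rpow_two, sq_abs]
    refine Real.rpow_le_rpow (sq_nonneg _) ?_ (by positivity)
    exact le_add_of_nonneg_right (mul_nonneg hD.le (hWpos x).le)
  have hQ : ∀ x, (φ x)⁻¹ ^ (d + 1) * ‖fderiv ℝ φ x‖ ^ 2 ≤
      4 / ((d : ℝ) - 1) ^ 2 * (‖fderiv ℝ u x‖ ^ 2 + D * (((d : ℝ) - 1) ^ 2 *
        (1 + ‖x‖ ^ 2)⁻¹ ^ d)) := by
    intro x
    have hWd := hasFDerivAt_inv_one_add_norm_sq_pow (d - 1) x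
    rw [Nat.sub_add_cancel (by omega : 1 ≤ d), hdc] at hWd
    have hud := ((hu.differentiable (by simp)) x).hasFDerivAt
    have hgd := (hud.pow 2).add (hWd.const_mul D)
    have hφd := hgd.rpow_const (p := s) (Or.inl (hgpos x).ne')
    have hWn : ‖(-(((d : ℝ) - 1) * (1 + ‖x‖ ^ 2)⁻¹ ^ d)) • ((2 : ℝ) • innerSL ℝ x)‖ ^ 2 ≤
        4 * W x * (((d : ℝ) - 1) ^ 2 * (1 + ‖x‖ ^ 2)⁻¹ ^ d) := by
      rw [norm_smul, norm_two_smul_innerSL, norm_neg, Real.norm_of_nonneg (by positivity)]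
      have h1 : W x = (1 + ‖x‖ ^ 2)⁻¹ ^ d * (1 + ‖x‖ ^ 2) := by
        rw [hW, ← pow_sub_one_mul (by omega : d ≠ 0) (1 + ‖x‖ ^ 2)⁻¹, mul_assoc,
          inv_mul_cancel₀ (by positivity), mul_one]
      rw [h1]
      have h2 : 0 ≤ 4 * (((d : ℝ) - 1) * (1 + ‖x‖ ^ 2)⁻¹ ^ d) ^ 2 := by positivity
      nlinarith
    have hgn := norm_two_mul_smul_add_smul_sq_le (a := fderiv ℝ u x) (u := u x) hD.le
      (hWpos x).le (by positivity) hWn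
    have e : (2 • u x ^ (2 - 1)) • fderiv ℝ u x = (2 * u x) • fderiv ℝ u x := by simp
    rw [e] at hφd
    change HasFDerivAt φ ((s * g x ^ (s - 1)) • _) x at hφd
    have e2 : g x ^ (((d : ℝ) + 1) / (d - 1)) * (s * g x ^ (s - 1)) ^ 2 =
        (((d : ℝ) - 1) ^ 2)⁻¹ * (g x)⁻¹ := by
      rw [mul_pow, mul_left_comm, ← Real.rpow_natCast (g x ^ (s - 1)), ← Real.rpow_mul (hgpos x).le,
        ← Real.rpow_add (hgpos x), ← Real.rpow_neg_one (g x), hs]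
      congr 1
      · field_simp
      · congr 1
        push_cast
        field_simp
        ring
    rw [hφd.fderiv, norm_smul, mul_pow, hφg, Real.norm_eq_abs, sq_abs, ← mul_assoc, e2]
    have h1 := hgpos x
    calc _ ≤ (((d : ℝ) - 1) ^ 2)⁻¹ * (g x)⁻¹ * (4 * (u x ^ 2 + D * W x) *
          (‖fderiv ℝ u x‖ ^ 2 + D * (((d : ℝ) - 1) ^ 2 * (1 + ‖x‖ ^ 2)⁻¹ ^ d))) := by gcongr
      _ = (((d : ℝ) - 1) ^ 2)⁻¹ * ((g x)⁻¹ * g x) * 4 *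
          (‖fderiv ℝ u x‖ ^ 2 + D * (((d : ℝ) - 1) ^ 2 * (1 + ‖x‖ ^ 2)⁻¹ ^ d)) := by
        simp only [hg]
        ring
      _ = _ := by
        rw [inv_mul_cancel₀ h1.ne']
        ring
  have hui : Integrable fun x => ‖fderiv ℝ u x‖ ^ 2 := by
    refine Continuous.integrable_of_hasCompactSupport
      ((hu.continuous_fderiv (by simp)).norm.pow 2) ?_
    exact (hc.fderiv ℝ).comp_left (g := fun a => ‖a‖ ^ 2) (by simp)
  have hΨi : Integrable fun x : EuclideanSpace ℝ (Fin (d + 1)) => (1 + ‖x‖ ^ 2)⁻¹ ^ d :=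
    integrable_inv_one_add_norm_sq_pow volume (by rw [finrank_euclideanSpace_fin]; omega)
  have h5 : ∫ x, (φ x)⁻¹ ^ (d + 1) * ‖fderiv ℝ φ x‖ ^ 2 ≤ 4 / ((d : ℝ) - 1) ^ 2 *
      ((∫ x, ‖fderiv ℝ u x‖ ^ 2) + D * (((d : ℝ) - 1) ^ 2 * ∫ x : EuclideanSpace ℝ (Fin (d + 1)), (1 + ‖x‖ ^ 2)⁻¹ ^ d)) := by
    refine (integral_mono_of_nonneg (Eventually.of_forall fun x => ?_)
      ((hui.add ((hΨi.const_mul _).const_mul D)).const_mul _)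
      (Eventually.of_forall hQ)).trans_eq ?_
    · have := hφpos x
      simp only [Pi.zero_apply]
      positivity
    · rw [integral_const_mul, integral_add' hui ((hΨi.const_mul _).const_mul D),
        integral_const_mul, integral_const_mul]
  have h6 : b ^ (2 / ((d : ℝ) + 1)) ≤
      (∫ x, (φ x)⁻¹ ^ (d + 1)) ^ (((d : ℝ) - 1) / (d + 1)) * b ^ (2 / ((d : ℝ) + 1)) :=
    le_mul_of_one_le_left (by positivity) (Real.one_le_rpow hP (by positivity))
  have h7 := (mul_le_mul_of_nonneg_left h6
    (by positivity : 0 ≤ 4 * ((d : ℝ) + 1) / (d - 1))).trans (key.trans h5)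
  have h8 : 0 < ((d : ℝ) - 1) ^ 2 / 4 := by positivity
  have h9 := mul_le_mul_of_nonneg_left h7 h8.le
  calc _ = ((d : ℝ) - 1) ^ 2 / 4 * (4 * ((d : ℝ) + 1) / (d - 1) * b ^ (2 / ((d : ℝ) + 1))) := by
        field_simp
    _ ≤ _ := h9
    _ = _ := by
        rw [← mul_assoc]
        field_simp

theorem sobolev_integral_ge {d : ℕ} (hd : 2 ≤ d)
    {u : EuclideanSpace ℝ (Fin (d + 1)) → ℝ} (hu : ContDiff ℝ (⊤ : ℕ∞) u)
    (hc : HasCompactSupport u)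
    (hu1 : ∫ x, |u x| ^ (2 * ((d : ℝ) + 1) / (d - 1)) = 1) :
    ((d : ℝ) + 1) * (d - 1) *
        (∫ x : EuclideanSpace ℝ (Fin (d + 1)), (1 + ‖x‖ ^ 2)⁻¹ ^ (d + 1)) ^ (2 / ((d : ℝ) + 1)) ≤
      ∫ x, ‖fderiv ℝ u x‖ ^ 2 := by
  refine sub_nonpos.1 (le_zero_of_forall_le_mul (C := ((d : ℝ) - 1) ^ 2 *
    ∫ x : EuclideanSpace ℝ (Fin (d + 1)), (1 + ‖x‖ ^ 2)⁻¹ ^ d) one_pos fun D hD _ => ?_)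
  have := (sobolev_integral_ge_of_pos hd hu hc hu1 hD)
  linarith

theorem integral_eq_pow_mul_integral_comp_smul {n : ℕ} (f : EuclideanSpace ℝ (Fin n) → ℝ) {l : ℝ}
    (hl : 0 < l) : ∫ x, f x = l ^ n * ∫ x, f (l • x) := by
  have h := Measure.integral_comp_smul volume f l
  rw [h, finrank_euclideanSpace_fin, smul_eq_mul, abs_of_pos (by positivity), ← mul_assoc,
    mul_inv_cancel₀ (by positivity), one_mul]

/-- The bubble of scale `l` on `ℝ^(d+1)`, truncated by `ζ`. -/
def truncatedBubble {d : ℕ} (ζ : EuclideanSpace ℝ (Fin (d + 1)) → ℝ) (l : ℝ)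
    (x : EuclideanSpace ℝ (Fin (d + 1))) : ℝ :=
  l ^ (((d : ℝ) - 1) / 2) * ζ x * (l ^ 2 + ‖x‖ ^ 2) ^ (-(((d : ℝ) - 1) / 2))

/-- The rescaled differential of the truncated bubble of scale `l`. -/
def bubbleDifferential {d : ℕ} (ζ : EuclideanSpace ℝ (Fin (d + 1)) → ℝ) (l : ℝ)
    (y : EuclideanSpace ℝ (Fin (d + 1))) : EuclideanSpace ℝ (Fin (d + 1)) →L[ℝ] ℝ :=
  (ζ (l • y) * (-(((d : ℝ) - 1) / 2) * (1 + ‖y‖ ^ 2) ^ (-(((d : ℝ) - 1) / 2) - 1))) •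
      ((2 : ℝ) • innerSL ℝ y) +
    (l * (1 + ‖y‖ ^ 2) ^ (-(((d : ℝ) - 1) / 2))) • fderiv ℝ ζ (l • y)

section

variable {d : ℕ} {ζ : EuclideanSpace ℝ (Fin (d + 1)) → ℝ} {l : ℝ}

theorem sq_add_norm_smul_sq (hl : 0 < l) (y : EuclideanSpace ℝ (Fin (d + 1))) :
    l ^ 2 + ‖l • y‖ ^ 2 = l ^ 2 * (1 + ‖y‖ ^ 2) := by
  rw [norm_smul, Real.norm_of_nonneg hl.le]
  ring

theorem sq_mul_rpow (hl : 0 < l) {t : ℝ} (ht : 0 ≤ t) (p : ℝ) :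
    (l ^ 2 * t) ^ p = l ^ (2 * p) * t ^ p := by
  rw [Real.mul_rpow (by positivity) ht, ← Real.rpow_natCast l 2, ← Real.rpow_mul hl.le]
  norm_num

theorem truncatedBubble_smul (hl : 0 < l) (y : EuclideanSpace ℝ (Fin (d + 1))) :
    truncatedBubble ζ l (l • y) =
      l ^ (-(((d : ℝ) - 1) / 2)) * (ζ (l • y) * (1 + ‖y‖ ^ 2) ^ (-(((d : ℝ) - 1) / 2))) := by
  rw [truncatedBubble, sq_add_norm_smul_sq hl, sq_mul_rpow hl (by positivity)]
  set m := ((d : ℝ) - 1) / 2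
  have h : l ^ m * l ^ (2 * -m) = l ^ (-m) := by
    rw [← Real.rpow_add hl]
    congr 1
    ring
  rw [← h]
  ring

theorem fderiv_truncatedBubble_smul (hζ : Differentiable ℝ ζ) (hl : 0 < l)
    (y : EuclideanSpace ℝ (Fin (d + 1))) :
    fderiv ℝ (truncatedBubble ζ l) (l • y) =
      l ^ (-(((d : ℝ) - 1) / 2 + 1)) • bubbleDifferential ζ l y := by
  unfold bubbleDifferential
  have h1 := (hasFDerivAt_const_add_norm_sq (l ^ 2) (l • y)).rpow_const
    (p := -(((d : ℝ) - 1) / 2)) (Or.inl (by positivity))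
  have h2 := ((hζ (l • y)).hasFDerivAt.const_mul (l ^ (((d : ℝ) - 1) / 2))).mul h1
  have h3 : fderiv ℝ (truncatedBubble ζ l) (l • y) = _ := h2.fderiv
  rw [h3, sq_add_norm_smul_sq hl, sq_mul_rpow hl (by positivity), sq_mul_rpow hl (by positivity)]
  set m := ((d : ℝ) - 1) / 2
  have e1 : l ^ m * l ^ (2 * (-m - 1)) * l = l ^ (-(m + 1)) := by
    nth_rw 3 [← Real.rpow_one l]
    rw [← Real.rpow_add hl, ← Real.rpow_add hl]
    congr 1
    ring
  have e2 : l ^ m * l ^ (2 * -m) = l ^ (-(m + 1)) * l := by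
    nth_rw 4 [← Real.rpow_one l]
    rw [← Real.rpow_add hl, ← Real.rpow_add hl]
    congr 1
    ring
  rw [smul_add, map_smul]
  simp only [smul_smul]
  congr 2
  · rw [← e1]
    ring
  · rw [← mul_assoc, ← e2]
    ring

theorem rpow_neg_half_sq {t : ℝ} (ht : 0 < t) (a : ℕ) {p : ℝ} (hp : 2 * p = -a) :
    (t ^ p) ^ 2 = t⁻¹ ^ a := by
  rw [← Real.rpow_natCast, ← Real.rpow_mul ht.le, ← Real.rpow_natCast, Real.inv_rpow ht.le,
    ← Real.rpow_neg ht.le]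
  congr 1
  push_cast
  linarith

theorem tendsto_integral_truncatedBubble_rpow (hd : 2 ≤ d) (hζ : Continuous ζ)
    (hζ01 : ∀ x, ζ x ∈ Icc (0 : ℝ) 1) (hζ0 : ζ 0 = 1) :
    Tendsto (fun l => ∫ x, |truncatedBubble ζ l x| ^ (2 * ((d : ℝ) + 1) / (d - 1))) (𝓝[>] 0)
      (𝓝 (∫ x : EuclideanSpace ℝ (Fin (d + 1)), (1 + ‖x‖ ^ 2)⁻¹ ^ (d + 1))) := by
  have hd1 : (0 : ℝ) < d - 1 := by
    have : (2 : ℝ) ≤ d := by exact_mod_cast hd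
    linarith
  set q : ℝ := 2 * ((d : ℝ) + 1) / (d - 1) with hq
  have hq0 : 0 < q := by positivity
  have hmq : ((d : ℝ) - 1) / 2 * q = ((d + 1 : ℕ) : ℝ) := by
    rw [hq]
    push_cast
    field_simp
  have hU : ∀ x : EuclideanSpace ℝ (Fin (d + 1)),
      ((1 + ‖x‖ ^ 2) ^ (-(((d : ℝ) - 1) / 2))) ^ q = (1 + ‖x‖ ^ 2)⁻¹ ^ (d + 1) := by
    intro x
    rw [← Real.rpow_mul (by positivity), ← Real.rpow_natCast (1 + ‖x‖ ^ 2)⁻¹,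
      Real.inv_rpow (by positivity), ← Real.rpow_neg (by positivity), ← hmq]
    congr 1
    ring
  have hev : ∀ l : ℝ, 0 < l → ∫ x, |truncatedBubble ζ l x| ^ q =
      ∫ x : EuclideanSpace ℝ (Fin (d + 1)), ζ (l • x) ^ q * (1 + ‖x‖ ^ 2)⁻¹ ^ (d + 1) := by
    intro l hl
    rw [integral_eq_pow_mul_integral_comp_smul _ hl, ← integral_const_mul]
    refine integral_congr_ae (Eventually.of_forall fun x => ?_)
    have h0 := (hζ01 (l • x)).1
    simp only
    rw [truncatedBubble_smul hl, abs_of_nonneg (by positivity), Real.mul_rpow (by positivity)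
      (by positivity), Real.mul_rpow h0 (by positivity), hU, ← Real.rpow_mul hl.le, neg_mul, hmq,
      Real.rpow_neg hl.le, Real.rpow_natCast, ← mul_assoc, mul_inv_cancel₀ (by positivity), one_mul]
  refine Tendsto.congr' (f₁ := fun l => ∫ x : EuclideanSpace ℝ (Fin (d + 1)),
    ζ (l • x) ^ q * (1 + ‖x‖ ^ 2)⁻¹ ^ (d + 1)) ?_ ?_
  · filter_upwards [self_mem_nhdsWithin] with l hl using (hev l hl).symm
  · refine tendsto_integral_filter_of_dominated_convergence (fun x => (1 + ‖x‖ ^ 2)⁻¹ ^ (d + 1))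
      (Eventually.of_forall fun l => ?_) (Eventually.of_forall fun l => Eventually.of_forall
        fun x => ?_) (integrable_inv_one_add_norm_sq_pow volume
          (by rw [finrank_euclideanSpace_fin]; omega)) (Eventually.of_forall fun x => ?_)
    · refine Measurable.aestronglyMeasurable ?_
      have := hζ.measurable
      fun_prop
    · have h0 := (hζ01 (l • x)).1
      rw [Real.norm_of_nonneg (by positivity)]
      exact mul_le_of_le_one_left (by positivity) (Real.rpow_le_one h0 (hζ01 _).2 hq0.le)
    · have h1 : Continuous fun l : ℝ => ζ (l • x) ^ q * (1 + ‖x‖ ^ 2)⁻¹ ^ (d + 1) :=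
        ((hζ.comp (by fun_prop)).rpow_const fun _ => Or.inr hq0.le).mul continuous_const
      have h2 := h1.tendsto 0
      simp only [zero_smul, hζ0, Real.one_rpow, one_mul] at h2
      exact h2.mono_left nhdsWithin_le_nhds

theorem continuous_bubbleDifferential (hζ : ContDiff ℝ (⊤ : ℕ∞) ζ) :
    Continuous fun p : ℝ × EuclideanSpace ℝ (Fin (d + 1)) => bubbleDifferential ζ p.1 p.2 := by
  unfold bubbleDifferential
  have h1 := hζ.continuous
  have h2 : Continuous (fderiv ℝ ζ) := hζ.continuous_fderiv (by simp)
  have h3 : ∀ a : ℝ, Continuous fun p : ℝ × EuclideanSpace ℝ (Fin (d + 1)) =>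
      (1 + ‖p.2‖ ^ 2) ^ a := fun a =>
    (by fun_prop : Continuous fun p : ℝ × EuclideanSpace ℝ (Fin (d + 1)) =>
      1 + ‖p.2‖ ^ 2).rpow_const fun p => Or.inl (by positivity)
  have h4 := h3 (-(((d : ℝ) - 1) / 2) - 1)
  have h5 := h3 (-(((d : ℝ) - 1) / 2))
  fun_prop

theorem norm_bubbleDifferential_zero_sq (hζ0 : ζ 0 = 1) (y : EuclideanSpace ℝ (Fin (d + 1))) :
    ‖bubbleDifferential ζ 0 y‖ ^ 2 =
      ((d : ℝ) - 1) ^ 2 * ((1 + ‖y‖ ^ 2)⁻¹ ^ d - (1 + ‖y‖ ^ 2)⁻¹ ^ (d + 1)) := by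
  unfold bubbleDifferential
  rw [zero_smul, hζ0, zero_mul, zero_smul, add_zero, one_mul, norm_smul, norm_two_smul_innerSL,
    mul_pow, Real.norm_eq_abs, sq_abs, mul_pow, rpow_neg_half_sq (by positivity) (d + 1)
      (by push_cast; ring)]
  have h : (1 + ‖y‖ ^ 2)⁻¹ ^ d = (1 + ‖y‖ ^ 2)⁻¹ ^ (d + 1) * (1 + ‖y‖ ^ 2) := by
    rw [pow_succ (1 + ‖y‖ ^ 2)⁻¹, mul_assoc, inv_mul_cancel₀ (by positivity), mul_one]
  rw [h]
  ring

theorem exists_norm_bubbleDifferential_sq_le (hd : 1 ≤ d) (hζ : ContDiff ℝ (⊤ : ℕ∞) ζ)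
    (hζc : HasCompactSupport ζ) (hζ01 : ∀ x, ζ x ∈ Icc (0 : ℝ) 1) :
    ∃ C : ℝ, 0 ≤ C ∧ ∀ l : ℝ, 0 < l → l ≤ 1 → ∀ y : EuclideanSpace ℝ (Fin (d + 1)),
      ‖bubbleDifferential ζ l y‖ ^ 2 ≤ C * (1 + ‖y‖ ^ 2)⁻¹ ^ d := by
  obtain ⟨C, hC⟩ := (((hζ.continuous_fderiv (by simp)).norm.pow 2).mul
    (by fun_prop : Continuous fun x : EuclideanSpace ℝ (Fin (d + 1)) =>
      1 + ‖x‖ ^ 2)).bounded_above_of_compact_support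
    (f := fun x => ‖fderiv ℝ ζ x‖ ^ 2 * (1 + ‖x‖ ^ 2))
    (HasCompactSupport.intro (hζc.fderiv ℝ) fun x hx => by
      simp [image_eq_zero_of_notMem_tsupport hx])
  have hC0 : 0 ≤ C := (norm_nonneg _).trans (hC 0)
  refine ⟨2 * ((d : ℝ) - 1) ^ 2 + 2 * C, by positivity, fun l hl hl1 y => ?_⟩
  unfold bubbleDifferential
  set ψ := 1 + ‖y‖ ^ 2 with hψ
  have hψ0 : 0 < ψ := by positivity
  set a := (ζ (l • y) * (-(((d : ℝ) - 1) / 2) * ψ ^ (-(((d : ℝ) - 1) / 2) - 1))) •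
      ((2 : ℝ) • innerSL ℝ y) with ha
  set b := (l * ψ ^ (-(((d : ℝ) - 1) / 2))) • fderiv ℝ ζ (l • y) with hb
  have h : ψ⁻¹ ^ d = ψ⁻¹ ^ (d + 1) * ψ := by
    rw [pow_succ, mul_assoc, inv_mul_cancel₀ hψ0.ne', mul_one]
  have h1 : ‖a‖ ^ 2 ≤ ((d : ℝ) - 1) ^ 2 * ψ⁻¹ ^ d := by
    rw [ha, norm_smul, norm_two_smul_innerSL, mul_pow, Real.norm_eq_abs, sq_abs, mul_pow, mul_pow,
      rpow_neg_half_sq hψ0 (d + 1) (by push_cast; ring), h]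
    have h2 : ζ (l • y) ^ 2 ≤ 1 := pow_le_one₀ (hζ01 _).1 (hζ01 _).2
    have h3 : ‖y‖ ^ 2 ≤ ψ := by linarith
    calc _ = ζ (l • y) ^ 2 * (((d : ℝ) - 1) ^ 2 * (ψ⁻¹ ^ (d + 1) * ‖y‖ ^ 2)) := by ring
      _ ≤ 1 * (((d : ℝ) - 1) ^ 2 * (ψ⁻¹ ^ (d + 1) * ψ)) := by gcongr
      _ = _ := one_mul _
  have h2 : ‖b‖ ^ 2 ≤ C * ψ⁻¹ ^ d := by
    rw [hb, norm_smul, mul_pow, Real.norm_eq_abs, sq_abs, mul_pow,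
      rpow_neg_half_sq hψ0 (d - 1) (by rw [Nat.cast_sub hd]; push_cast; ring)]
    have h3 := (le_abs_self _).trans (hC (l • y))
    have h4 : l ^ 2 * ψ ≤ 1 + ‖l • y‖ ^ 2 := by
      rw [norm_smul, Real.norm_of_nonneg hl.le]
      nlinarith
    have h5 : ψ⁻¹ ^ (d - 1) = ψ⁻¹ ^ d * ψ := by
      rw [← pow_sub_one_mul (by omega : d ≠ 0) ψ⁻¹, mul_assoc, inv_mul_cancel₀ hψ0.ne', mul_one]
    rw [h5]
    calc _ = ‖fderiv ℝ ζ (l • y)‖ ^ 2 * (l ^ 2 * ψ) * ψ⁻¹ ^ d := by ring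
      _ ≤ ‖fderiv ℝ ζ (l • y)‖ ^ 2 * (1 + ‖l • y‖ ^ 2) * ψ⁻¹ ^ d := by gcongr
      _ ≤ _ := by gcongr
  have h3 : ‖a + b‖ ^ 2 ≤ 2 * ‖a‖ ^ 2 + 2 * ‖b‖ ^ 2 := by
    have := norm_add_le a b
    nlinarith [norm_nonneg (a + b), sq_nonneg (‖a‖ - ‖b‖)]
  linarith

theorem bubbleDifferential_eq_zero {y : EuclideanSpace ℝ (Fin (d + 1))}
    (h : l • y ∉ tsupport ζ) : bubbleDifferential ζ l y = 0 := by
  have h2 : fderiv ℝ ζ (l • y) = 0 :=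
    image_eq_zero_of_notMem_tsupport fun h3 => h (tsupport_fderiv_subset ℝ h3)
  rw [bubbleDifferential, image_eq_zero_of_notMem_tsupport h, h2]
  simp

theorem tendsto_integral_weighted_fderiv_truncatedBubble (hd : 2 ≤ d)
    (hζ : ContDiff ℝ (⊤ : ℕ∞) ζ) (hζc : HasCompactSupport ζ) (hζ01 : ∀ x, ζ x ∈ Icc (0 : ℝ) 1)
    (hζ0 : ζ 0 = 1) {β k : ℝ} (hk : 0 ≤ k) (hβ : ((d : ℝ) - 1) / 2 * k < β) {a : ℝ → ℝ} {A : ℝ}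
    (ha : ∀ᶠ l in 𝓝[>] 0, |a l| ≤ A) :
    Tendsto (fun l => ∫ x, (1 + a l * (‖x‖ ^ β * |truncatedBubble ζ l x| ^ k)) *
        ‖fderiv ℝ (truncatedBubble ζ l) x‖ ^ 2) (𝓝[>] 0)
      (𝓝 (((d : ℝ) + 1) * (d - 1) *
        ∫ x : EuclideanSpace ℝ (Fin (d + 1)), (1 + ‖x‖ ^ 2)⁻¹ ^ (d + 1))) := by
  have hd1 : (0 : ℝ) < d - 1 := by
    have : (2 : ℝ) ≤ d := by exact_mod_cast hd
    linarith
  have iΨ : ∀ m, d ≤ m → Integrable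
      (fun x : EuclideanSpace ℝ (Fin (d + 1)) => (1 + ‖x‖ ^ 2)⁻¹ ^ m) := fun m hm =>
    integrable_inv_one_add_norm_sq_pow volume (by rw [finrank_euclideanSpace_fin]; omega)
  have hlim : ∫ y, ‖bubbleDifferential ζ 0 y‖ ^ 2 = ((d : ℝ) + 1) * (d - 1) *
        ∫ x : EuclideanSpace ℝ (Fin (d + 1)), (1 + ‖x‖ ^ 2)⁻¹ ^ (d + 1) := by
    have h1 := integral_inv_one_add_norm_sq_pow_eq hd
    simp_rw [norm_bubbleDifferential_zero_sq hζ0]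
    rw [integral_const_mul, integral_sub (iΨ d le_rfl) (iΨ (d + 1) d.le_succ), mul_sub, sq,
      mul_assoc, h1]
    ring
  rw [← hlim]
  set m := ((d : ℝ) - 1) / 2 with hm
  have hm0 : 0 < m := by positivity
  set γ := β - m * k with hγ
  have hγ0 : 0 < γ := sub_pos.2 hβ
  set T : ℝ → EuclideanSpace ℝ (Fin (d + 1)) → ℝ := fun l y =>
    l ^ γ * (‖y‖ ^ β * (ζ (l • y) * (1 + ‖y‖ ^ 2) ^ (-m)) ^ k) with hT
  have hev : ∀ l : ℝ, 0 < l → ∫ x, (1 + a l * (‖x‖ ^ β * |truncatedBubble ζ l x| ^ k)) *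
        ‖fderiv ℝ (truncatedBubble ζ l) x‖ ^ 2 =
      ∫ y, (1 + a l * T l y) * ‖bubbleDifferential ζ l y‖ ^ 2 := by
    intro l hl
    rw [integral_eq_pow_mul_integral_comp_smul _ hl, ← integral_const_mul]
    refine integral_congr_ae (Eventually.of_forall fun y => ?_)
    have h0 := (hζ01 (l • y)).1
    simp only
    rw [fderiv_truncatedBubble_smul (hζ.differentiable (by simp)) hl, truncatedBubble_smul hl,
      ← hm, norm_smul l, Real.norm_of_nonneg hl.le, norm_smul,
      Real.norm_of_nonneg (by positivity : 0 ≤ l ^ (-(m + 1))), mul_pow,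
      rpow_neg_half_sq hl (d + 1) (by push_cast; rw [hm]; ring), abs_of_nonneg (by positivity),
      Real.mul_rpow hl.le (norm_nonneg _), Real.mul_rpow (by positivity) (by positivity),
      ← Real.rpow_mul hl.le, hT]
    have e : l ^ γ = l ^ β * l ^ (-m * k) := by
      rw [← Real.rpow_add hl, hγ]
      congr 1
      ring
    simp only
    rw [e, inv_pow]
    field_simp
  have hT0 : ∀ l y, 0 < l → 0 ≤ T l y := fun l y hl => by
    have h0 := (hζ01 (l • y)).1
    positivity
  have hTle : ∀ l y, 0 < l → T l y ≤ ‖l • y‖ ^ γ := by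
    intro l y hl
    have h0 := hζ01 (l • y)
    have e : ‖y‖ ^ β = ‖y‖ ^ γ * ‖y‖ ^ (m * k) := by
      rw [← Real.rpow_add_of_nonneg (norm_nonneg _) hγ0.le (by positivity), hγ, sub_add_cancel]
    have h1 : ‖y‖ ^ (m * k) * (ζ (l • y) * (1 + ‖y‖ ^ 2) ^ (-m)) ^ k ≤ 1 := by
      rw [Real.rpow_mul (norm_nonneg _), ← Real.mul_rpow (by positivity)
        (mul_nonneg h0.1 (by positivity))]
      refine Real.rpow_le_one (mul_nonneg (by positivity) (mul_nonneg h0.1 (by positivity))) ?_ hk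
      have h2 : ‖y‖ ^ m ≤ (1 + ‖y‖ ^ 2) ^ m :=
        Real.rpow_le_rpow (norm_nonneg _) (by nlinarith [sq_nonneg (‖y‖ - 1)]) hm0.le
      calc _ ≤ (1 + ‖y‖ ^ 2) ^ m * (1 * (1 + ‖y‖ ^ 2) ^ (-m)) := by
            gcongr
            · exact mul_nonneg h0.1 (by positivity)
            · exact h0.2
        _ = 1 := by
            rw [one_mul, ← Real.rpow_add (by positivity), add_neg_cancel, Real.rpow_zero]
    rw [norm_smul, Real.norm_of_nonneg hl.le, Real.mul_rpow hl.le (norm_nonneg _), hT]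
    simp only
    rw [e, mul_assoc (‖y‖ ^ γ), ← mul_assoc]
    exact mul_le_of_le_one_right (by positivity) h1
  obtain ⟨C, hC0, hC⟩ := exists_norm_bubbleDifferential_sq_le (by omega) hζ hζc hζ01
  obtain ⟨R, hR⟩ := hζc.isBounded.subset_closedBall 0
  have hR0 : 0 ≤ R := by
    have h0 : (0 : EuclideanSpace ℝ (Fin (d + 1))) ∈ tsupport ζ :=
      subset_tsupport _ (by simp [hζ0])
    simpa using hR h0
  have hlt : ∀ᶠ l in 𝓝[>] (0 : ℝ), l ≤ 1 :=
    nhdsWithin_le_nhds (Iic_mem_nhds one_pos)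
  have hA : 0 ≤ A := by
    obtain ⟨l, hl⟩ := ha.exists
    exact (abs_nonneg _).trans hl
  refine Tendsto.congr' (f₁ := fun l => ∫ y, (1 + a l * T l y) * ‖bubbleDifferential ζ l y‖ ^ 2)
    ?_ ?_
  · filter_upwards [self_mem_nhdsWithin] with l hl using (hev l hl).symm
  have hcont := continuous_bubbleDifferential hζ
  refine tendsto_integral_filter_of_dominated_convergence
    (fun x => (1 + A * R ^ γ) * (C * (1 + ‖x‖ ^ 2)⁻¹ ^ d)) (Eventually.of_forall fun l => ?_) ?_
    (((iΨ d le_rfl).const_mul _).const_mul _) (Eventually.of_forall fun y => ?_)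
  · refine Measurable.aestronglyMeasurable ?_
    have h1 := hζ.continuous.measurable
    have h2 : Measurable fun y => bubbleDifferential ζ l y :=
      (hcont.comp (by fun_prop : Continuous fun y : EuclideanSpace ℝ (Fin (d + 1)) =>
        (l, y))).measurable
    simp only [hT]
    fun_prop
  · filter_upwards [self_mem_nhdsWithin, hlt, ha] with l hl hl1 hal
    refine Eventually.of_forall fun y => ?_
    rw [norm_mul, norm_pow, norm_norm]
    by_cases hy : l • y ∈ tsupport ζ
    · refine mul_le_mul ?_ (hC l hl hl1 y) (by positivity) (by positivity)
      refine (norm_add_le _ _).trans ?_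
      rw [norm_one, norm_mul, Real.norm_eq_abs, Real.norm_of_nonneg (hT0 l y hl)]
      have h1 : T l y ≤ R ^ γ := (hTle l y hl).trans
        (Real.rpow_le_rpow (norm_nonneg _) (by simpa using hR hy) hγ0.le)
      have := hT0 l y hl
      gcongr
    · rw [bubbleDifferential_eq_zero hy]
      simp only [norm_zero]
      rw [zero_pow two_ne_zero, mul_zero]
      positivity
  · have h1 : Tendsto (fun l => ‖bubbleDifferential ζ l y‖ ^ 2) (𝓝[>] 0)
        (𝓝 (‖bubbleDifferential ζ 0 y‖ ^ 2)) := by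
      have h2 : Continuous fun l => ‖bubbleDifferential ζ l y‖ ^ 2 :=
        ((hcont.comp (by fun_prop : Continuous fun l : ℝ => (l, y))).norm.pow 2)
      exact (h2.tendsto 0).mono_left nhdsWithin_le_nhds
    have h3 : Tendsto (fun l => a l * T l y) (𝓝[>] 0) (𝓝 0) := by
      have h4 : Tendsto (fun l : ℝ => A * ‖l • y‖ ^ γ) (𝓝[>] 0) (𝓝 0) := by
        have h5 : Continuous fun l : ℝ => A * ‖l • y‖ ^ γ :=
          continuous_const.mul ((by fun_prop : Continuous fun l : ℝ => ‖l • y‖).rpow_const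
            fun _ => Or.inr hγ0.le)
        have h6 := h5.tendsto 0
        simp only [zero_smul, norm_zero, Real.zero_rpow hγ0.ne', mul_zero] at h6
        exact h6.mono_left nhdsWithin_le_nhds
      refine squeeze_zero_norm' ?_ h4
      filter_upwards [self_mem_nhdsWithin, ha] with l hl hal
      rw [norm_mul, Real.norm_eq_abs, Real.norm_of_nonneg (hT0 l y hl)]
      have := hT0 l y hl
      gcongr
      exact hTle l y hl
    have h7 := (h3.const_add 1).mul h1
    rwa [add_zero, one_mul] at h7

end

theorem norm_gradient {F : Type*} [NormedAddCommGroup F] [InnerProductSpace ℝ F] [CompleteSpace F]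
    (f : F → ℝ) (x : F) : ‖gradient f x‖ = ‖fderiv ℝ f x‖ :=
  LinearIsometryEquiv.norm_map _ _

section

variable {n : ℕ} {Ω : Set (EuclideanSpace ℝ (Fin n))} {w : EuclideanSpace ℝ (Fin n) → ℝ}

theorem setIntegral_abs_rpow_eq_integral (hw : tsupport w ⊆ Ω) {q : ℝ} (hq : q ≠ 0) :
    ∫ x in Ω, |w x| ^ q = ∫ x, |w x| ^ q := by
  refine setIntegral_eq_integral_of_forall_compl_eq_zero fun x hx => ?_
  rw [image_eq_zero_of_notMem_tsupport fun h => hx (hw h), abs_zero, Real.zero_rpow hq]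

theorem fderiv_eq_zero_of_notMem (hw : tsupport w ⊆ Ω) {x : EuclideanSpace ℝ (Fin n)}
    (hx : x ∉ Ω) : fderiv ℝ w x = 0 :=
  image_eq_zero_of_notMem_tsupport fun h => hx (hw (tsupport_fderiv_subset ℝ h))

theorem setIntegral_norm_gradient_sq_eq_integral (hw : tsupport w ⊆ Ω) :
    ∫ x in Ω, ‖gradient w x‖ ^ 2 = ∫ x, ‖fderiv ℝ w x‖ ^ 2 := by
  simp_rw [norm_gradient]
  refine setIntegral_eq_integral_of_forall_compl_eq_zero fun x hx => ?_
  simp [fderiv_eq_zero_of_notMem hw hx]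

theorem energy_eq_integral (hw : tsupport w ⊆ Ω) (β k : ℝ) :
    energy n Ω β k w = ∫ x, (1 + ‖x‖ ^ β * |w x| ^ k) * ‖fderiv ℝ w x‖ ^ 2 := by
  unfold energy
  simp_rw [norm_gradient]
  refine setIntegral_eq_integral_of_forall_compl_eq_zero fun x hx => ?_
  simp [fderiv_eq_zero_of_notMem hw hx]

theorem tsupport_div_const_subset (N : ℝ) : tsupport (fun x => w x / N) ⊆ tsupport w :=
  closure_mono fun x hx h => hx (by simp [h])

theorem smoothCpt.div_const (h : smoothCpt n Ω w) (N : ℝ) : smoothCpt n Ω fun x => w x / N :=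
  ⟨h.1.div_const N, h.2.1.mono fun x hx h => hx (by simp [h]),
    (tsupport_div_const_subset N).trans h.2.2⟩

theorem norm_fderiv_div_const_sq (hw : Differentiable ℝ w) (N : ℝ) (x : EuclideanSpace ℝ (Fin n)) :
    ‖fderiv ℝ (fun x => w x / N) x‖ ^ 2 = N⁻¹ ^ 2 * ‖fderiv ℝ w x‖ ^ 2 := by
  simp_rw [div_eq_inv_mul]
  rw [fderiv_const_mul (hw x), norm_smul, mul_pow, Real.norm_eq_abs, sq_abs]

theorem smoothCpt.energy_div_const (h : smoothCpt n Ω w) {N : ℝ} (hN : 0 ≤ N) (β k : ℝ) :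
    energy n Ω β k (fun x => w x / N) =
      N⁻¹ ^ 2 * ∫ x, (1 + N⁻¹ ^ k * (‖x‖ ^ β * |w x| ^ k)) * ‖fderiv ℝ w x‖ ^ 2 := by
  rw [energy_eq_integral (h.div_const N).2.2, ← integral_const_mul]
  refine integral_congr_ae (Eventually.of_forall fun x => ?_)
  simp only
  rw [norm_fderiv_div_const_sq (h.1.differentiable (by simp)), div_eq_inv_mul, abs_mul,
    abs_of_nonneg (inv_nonneg.2 hN), Real.mul_rpow (inv_nonneg.2 hN) (abs_nonneg _)]
  ring

theorem smoothCpt.setIntegral_norm_gradient_div_const_sq (h : smoothCpt n Ω w) (N : ℝ) :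
    ∫ x in Ω, ‖gradient (fun x => w x / N) x‖ ^ 2 = N⁻¹ ^ 2 * ∫ x, ‖fderiv ℝ w x‖ ^ 2 := by
  rw [setIntegral_norm_gradient_sq_eq_integral (h.div_const N).2.2, ← integral_const_mul]
  exact integral_congr_ae
    (Eventually.of_forall fun x => norm_fderiv_div_const_sq (h.1.differentiable (by simp)) N x)

theorem setIntegral_abs_div_rpow_eq_one {q : ℝ} (hq : 0 < q)
    (hpos : 0 < ∫ x in Ω, |w x| ^ q) :
    ∫ x in Ω, |w x / (∫ y in Ω, |w y| ^ q) ^ (1 / q)| ^ q = 1 := by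
  set I := ∫ x in Ω, |w x| ^ q with hI
  have h : ∀ x, |w x / I ^ (1 / q)| ^ q = I⁻¹ * |w x| ^ q := by
    intro x
    rw [abs_div, abs_of_pos (Real.rpow_pos_of_pos hpos _), Real.div_rpow (abs_nonneg _)
      (by positivity), ← Real.rpow_mul hpos.le, one_div_mul_cancel hq.ne', Real.rpow_one,
      div_eq_inv_mul]
  simp_rw [h]
  rw [integral_const_mul, ← hI, inv_mul_cancel₀ hpos.ne']

end

theorem integral_inv_one_add_norm_sq_pow_pos (d : ℕ) :
    0 < ∫ x : EuclideanSpace ℝ (Fin (d + 1)), (1 + ‖x‖ ^ 2)⁻¹ ^ (d + 1) := by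
  rw [integral_pos_iff_support_of_nonneg (fun x => by positivity)
    (integrable_inv_one_add_norm_sq_pow volume (by rw [finrank_euclideanSpace_fin]; omega))]
  have h : Function.support (fun x : EuclideanSpace ℝ (Fin (d + 1)) =>
      (1 + ‖x‖ ^ 2)⁻¹ ^ (d + 1)) = univ :=
    eq_univ_of_forall fun x => ne_of_gt (by positivity)
  rw [h]
  exact Measure.measure_univ_pos.2 (NeZero.ne _)

section

variable {d : ℕ} {ζ : EuclideanSpace ℝ (Fin (d + 1)) → ℝ} {Ω : Set (EuclideanSpace ℝ (Fin (d + 1)))}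

theorem smoothCpt_truncatedBubble (hζ : smoothCpt (d + 1) Ω ζ) {l : ℝ} (hl : 0 < l) :
    smoothCpt (d + 1) Ω (truncatedBubble ζ l) := by
  have h0 : Function.support (truncatedBubble ζ l) ⊆ Function.support ζ := fun x hx h =>
    hx (by simp [truncatedBubble, h])
  refine ⟨?_, hζ.2.1.mono h0, (closure_mono h0).trans hζ.2.2⟩
  exact (contDiff_const.mul hζ.1).mul ((contDiff_const.add (contDiff_norm_sq ℝ)).rpow_const_of_ne
    fun x => by positivity)

theorem tendsto_energy_normalized_truncatedBubble (hd : 2 ≤ d) (hζ : smoothCpt (d + 1) Ω ζ)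
    (hζ01 : ∀ x, ζ x ∈ Icc (0 : ℝ) 1) (hζ0 : ζ 0 = 1) {β k : ℝ} (hk : 0 ≤ k)
    (hβ : ((d : ℝ) - 1) / 2 * k < β) {a : ℝ → ℝ} {A : ℝ} {q : ℝ}
    (hq : q = 2 * ((d : ℝ) + 1) / (d - 1)) (ha : ∀ᶠ l in 𝓝[>] 0, |a l| ≤ A) :
    Tendsto (fun l => ((∫ x, |truncatedBubble ζ l x| ^ q) ^ (1 / q))⁻¹ ^ 2 *
        ∫ x, (1 + a l * (‖x‖ ^ β * |truncatedBubble ζ l x| ^ k)) *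
          ‖fderiv ℝ (truncatedBubble ζ l) x‖ ^ 2) (𝓝[>] 0)
      (𝓝 (((d : ℝ) + 1) * (d - 1) * (∫ x : EuclideanSpace ℝ (Fin (d + 1)),
        (1 + ‖x‖ ^ 2)⁻¹ ^ (d + 1)) ^ (2 / ((d : ℝ) + 1)))) := by
  have hd1 : (0 : ℝ) < d - 1 := by
    have : (2 : ℝ) ≤ d := by exact_mod_cast hd
    linarith
  have hB := integral_inv_one_add_norm_sq_pow_pos d
  have h1 := tendsto_integral_truncatedBubble_rpow hd hζ.1.continuous hζ01 hζ0
  have h2 := tendsto_integral_weighted_fderiv_truncatedBubble hd hζ.1 hζ.2.1 hζ01 hζ0 hk hβ ha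
  rw [← hq] at h1
  set B := ∫ x : EuclideanSpace ℝ (Fin (d + 1)), (1 + ‖x‖ ^ 2)⁻¹ ^ (d + 1)
  have h3 := (((h1.rpow_const (p := 1 / q) (Or.inl hB.ne')).inv₀
    (Real.rpow_pos_of_pos hB _).ne').pow 2).mul h2
  have e : (B ^ (1 / q))⁻¹ ^ 2 * (((d : ℝ) + 1) * (d - 1) * B) =
      ((d : ℝ) + 1) * (d - 1) * B ^ (2 / ((d : ℝ) + 1)) := by
    have e1 : (B ^ (1 / q))⁻¹ ^ 2 * B = B ^ (2 / ((d : ℝ) + 1)) := by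
      rw [← Real.rpow_neg hB.le, ← Real.rpow_natCast, ← Real.rpow_mul hB.le]
      nth_rw 2 [← Real.rpow_one B]
      rw [← Real.rpow_add hB, hq]
      congr 1
      push_cast
      field_simp
      ring
    rw [← e1]
    ring
  rwa [e] at h3

theorem Sbest_eq (hd : 2 ≤ d) (hζ : smoothCpt (d + 1) Ω ζ) (hζ01 : ∀ x, ζ x ∈ Icc (0 : ℝ) 1)
    (hζ0 : ζ 0 = 1) {q : ℝ} (hq : q = 2 * ((d : ℝ) + 1) / (d - 1)) :
    Sbest (d + 1) Ω q = ((d : ℝ) + 1) * (d - 1) * (∫ x : EuclideanSpace ℝ (Fin (d + 1)),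
      (1 + ‖x‖ ^ 2)⁻¹ ^ (d + 1)) ^ (2 / ((d : ℝ) + 1)) := by
  have hd1 : (0 : ℝ) < d - 1 := by
    have : (2 : ℝ) ≤ d := by exact_mod_cast hd
    linarith
  have hq0 : 0 < q := by
    rw [hq]
    positivity
  have hadm : ∀ᶠ l in 𝓝[>] (0 : ℝ),
      ((∫ x, |truncatedBubble ζ l x| ^ q) ^ (1 / q))⁻¹ ^ 2 *
        ∫ x, ‖fderiv ℝ (truncatedBubble ζ l) x‖ ^ 2 ∈
      {c | ∃ u, smoothCpt (d + 1) Ω u ∧ (∫ x in Ω, |u x| ^ q) = 1 ∧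
        c = ∫ x in Ω, ‖gradient u x‖ ^ 2} := by
    have h1 := tendsto_integral_truncatedBubble_rpow hd hζ.1.continuous hζ01 hζ0
    rw [← hq] at h1
    filter_upwards [self_mem_nhdsWithin,
      h1.eventually_const_lt (integral_inv_one_add_norm_sq_pow_pos d)] with l hl hpos
    have hs := smoothCpt_truncatedBubble hζ hl
    rw [← setIntegral_abs_rpow_eq_integral hs.2.2 hq0.ne'] at hpos ⊢
    exact ⟨_, hs.div_const _, setIntegral_abs_div_rpow_eq_one hq0 hpos,
      (hs.setIntegral_norm_gradient_div_const_sq _).symm⟩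
  refine le_antisymm ?_ ?_
  · have h1 := tendsto_energy_normalized_truncatedBubble hd hζ hζ01 hζ0 (β := 1) (k := 0)
      (a := fun _ => 0) (A := 0) le_rfl (by simp) hq (by simp)
    simp only [zero_mul, add_zero, one_mul] at h1
    refine ge_of_tendsto h1 ?_
    filter_upwards [hadm] with l hl
    refine csInf_le ⟨0, ?_⟩ hl
    rintro c ⟨u, -, -, rfl⟩
    exact integral_nonneg fun x => by positivity
  · obtain ⟨l, hl⟩ := hadm.exists
    refine le_csInf ⟨_, hl⟩ ?_
    rintro c ⟨u, hu, hu1, rfl⟩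
    rw [setIntegral_norm_gradient_sq_eq_integral hu.2.2]
    rw [setIntegral_abs_rpow_eq_integral hu.2.2 hq0.ne', hq] at hu1
    exact sobolev_integral_ge hd hu.1 hu.2.1 hu1

end

/-- Supercritical case `β > kn/q`: the normalized instanton family
`u_ε(x) = ε^{(n-2)/4} ζ(x) (ε+|x|²)^{-(n-2)/2}` is a minimizing sequence for the weighted
functional: `I_{Ω;β,k}(u_ε/‖u_ε‖_{L^q}) → S` as `ε → 0⁺`. -/
theorem stmt_4 (n : ℕ) (hn : 3 ≤ n) (q : ℝ) (hq : q = 2 * n / (n - 2))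
    (Ω : Set (EuclideanSpace ℝ (Fin n))) (hΩo : IsOpen Ω)
    (hΩb : Bornology.IsBounded Ω) (h0 : 0 ∈ Ω)
    (β k : ℝ) (hk0 : 0 ≤ k) (hkq : k ≤ q) (hβ : β > k * n / q)
    (ζ : EuclideanSpace ℝ (Fin n) → ℝ) (hζs : ContDiff ℝ (⊤ : ℕ∞) ζ)
    (hζc : HasCompactSupport ζ) (hζΩ : tsupport ζ ⊆ Ω)
    (hζ01 : ∀ x, ζ x ∈ Set.Icc (0:ℝ) 1) (hζ1 : ζ =ᶠ[𝓝 0] fun _ => (1:ℝ))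
    (u : ℝ → EuclideanSpace ℝ (Fin n) → ℝ)
    (hu : ∀ ε x, u ε x = ε ^ ((n - 2 : ℝ)/4) * ζ x * (ε + ‖x‖ ^ 2) ^ (-((n : ℝ) - 2)/2)) :
    Tendsto (fun ε =>
        energy n Ω β k (fun x => u ε x / (∫ y in Ω, |u ε y| ^ q) ^ (1/q)))
      (𝓝[>] 0) (𝓝 (Sbest n Ω q)) := by
  obtain ⟨d, rfl⟩ : ∃ d, n = d + 1 := ⟨n - 1, by omega⟩
  have hd : 2 ≤ d := by omega
  have hd1 : (0 : ℝ) < d - 1 := by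
    have : (2 : ℝ) ≤ d := by exact_mod_cast hd
    linarith
  have hn2 : ((d + 1 : ℕ) : ℝ) - 2 = d - 1 := by
    push_cast
    ring
  have hn1 : ((d + 1 : ℕ) : ℝ) = d + 1 := by push_cast; rfl
  rw [hn2, hn1] at hq
  rw [hn1] at hβ
  have hq0 : 0 < q := by
    rw [hq]
    positivity
  have hβ' : ((d : ℝ) - 1) / 2 * k < β := by
    refine lt_of_eq_of_lt ?_ hβ
    rw [hq]
    field_simp
  have hζ0 : ζ 0 = 1 := hζ1.eq_of_nhds
  have hζ : smoothCpt (d + 1) Ω ζ := ⟨hζs, hζc, hζΩ⟩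
  rw [Sbest_eq hd hζ hζ01 hζ0 hq]
  have hub : ∀ ε, 0 < ε → u ε = truncatedBubble ζ √ε := by
    intro ε hε
    ext x
    rw [hu, truncatedBubble, hn2, Real.sq_sqrt hε.le, Real.sqrt_eq_rpow, ← Real.rpow_mul hε.le]
    congr 3 <;> ring
  have hsqrt : Tendsto Real.sqrt (𝓝[>] 0) (𝓝[>] 0) := by
    refine tendsto_nhdsWithin_iff.2 ⟨?_, ?_⟩
    · have h := Real.continuous_sqrt.tendsto 0
      rw [Real.sqrt_zero] at h
      exact h.mono_left nhdsWithin_le_nhds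
    · filter_upwards [self_mem_nhdsWithin] with ε hε using Real.sqrt_pos.2 hε
  set N : ℝ → ℝ := fun l => (∫ x, |truncatedBubble ζ l x| ^ q) ^ (1 / q) with hN
  have hNlim : Tendsto (fun l => (N l)⁻¹ ^ k) (𝓝[>] 0) (𝓝
      (((∫ x : EuclideanSpace ℝ (Fin (d + 1)), (1 + ‖x‖ ^ 2)⁻¹ ^ (d + 1)) ^ (1 / q))⁻¹ ^ k)) := by
    have hB := integral_inv_one_add_norm_sq_pow_pos d
    have h1 := tendsto_integral_truncatedBubble_rpow hd hζs.continuous hζ01 hζ0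
    rw [← hq] at h1
    have h2 := Real.rpow_pos_of_pos hB (1 / q)
    exact ((h1.rpow_const (Or.inl hB.ne')).inv₀ h2.ne').rpow_const (Or.inl (inv_ne_zero h2.ne'))
  have hmain := (tendsto_energy_normalized_truncatedBubble hd hζ hζ01 hζ0 hk0 hβ' hq
    (hNlim.abs.eventually_le_const (lt_add_one _))).comp hsqrt
  refine hmain.congr' ?_
  filter_upwards [self_mem_nhdsWithin] with ε hε
  have hs := smoothCpt_truncatedBubble hζ (Real.sqrt_pos.2 hε)
  simp only [Function.comp_apply, hub ε hε]
  rw [setIntegral_abs_rpow_eq_integral hs.2.2 hq0.ne', hs.energy_div_const]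
  exact Real.rpow_nonneg (integral_nonneg fun x => by positivity) _

end
end

section
/- Suppose 0 < k ≤ q and k(n−2)/2 < β < (k+1)(n−2). Then, as ε → 0⁺, ∫_Ω |x|^β u_ε(x)^k |∇u_ε(x)|² dx = C ε^{(2β−k(n−2))/4} + o( ε^{(2β−k(n−2))/4} ), where C = (n−2)² ∫_{ℝⁿ} |y|^{β+2} (1+|y|²)^{−(k(n−2)/2 + n)} dy is a finite positive constant. -/
open MeasureTheory Filter Topology Set

noncomputable section

theorem hasGradientAt_const_mul_mul_rpow {E : Type*} [NormedAddCommGroup E]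
    [InnerProductSpace ℝ E] [CompleteSpace E] {ζ : E → ℝ} {g x : E} {c ε p : ℝ}
    (hε : 0 < ε) (hζ : HasGradientAt ζ g x) :
    HasGradientAt (fun x => c * ζ x * (ε + ‖x‖ ^ 2) ^ p)
      (c • ((ε + ‖x‖ ^ 2) ^ p • g + (2 * p * ζ x * (ε + ‖x‖ ^ 2) ^ (p - 1)) • x)) x := by
  have hP : ε + ‖x‖ ^ 2 ≠ 0 := by positivity
  have hw : HasFDerivAt (fun x : E => ε + ‖x‖ ^ 2) ((2 : ℝ) • innerSL ℝ x) x := by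
    simpa [← Nat.cast_smul_eq_nsmul ℝ] using
      (hasStrictFDerivAt_norm_sq x).hasFDerivAt.const_add ε
  have h := (hζ.hasFDerivAt.const_mul c).mul (hw.rpow_const (p := p) (Or.inl hP))
  rw [hasGradientAt_iff_hasFDerivAt]
  refine h.congr_fderiv ?_
  ext v
  simp
  ring

theorem integrable_norm_rpow_mul_one_add_norm_sq_rpow {E : Type*} [NormedAddCommGroup E]
    [NormedSpace ℝ E] [FiniteDimensional ℝ E] [MeasurableSpace E] [BorelSpace E]
    (μ : Measure E) [μ.IsAddHaarMeasure] {a b : ℝ} (ha : 0 ≤ a)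
    (hab : Module.finrank ℝ E + a < 2 * b) :
    Integrable (fun y : E => ‖y‖ ^ a * (1 + ‖y‖ ^ 2) ^ (-b)) μ := by
  have h := integrable_rpow_neg_one_add_norm_sq (E := E) (μ := μ) (r := 2 * b - a) (by linarith)
  refine h.mono (by fun_prop) (.of_forall fun y => ?_)
  have hP : 0 < 1 + ‖y‖ ^ 2 := by positivity
  rw [Real.norm_of_nonneg (by positivity), Real.norm_of_nonneg (by positivity)]
  calc ‖y‖ ^ a * (1 + ‖y‖ ^ 2) ^ (-b)
      ≤ (1 + ‖y‖ ^ 2) ^ (a / 2) * (1 + ‖y‖ ^ 2) ^ (-b) := by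
        gcongr
        calc ‖y‖ ^ a = (‖y‖ ^ 2) ^ (a / 2) := by
              rw [← Real.rpow_natCast_mul (norm_nonneg y)]; congr 1; push_cast; ring
          _ ≤ _ := by gcongr; linarith
    _ = (1 + ‖y‖ ^ 2) ^ (-(2 * b - a) / 2) := by
        rw [← Real.rpow_add hP]; congr 1; ring

theorem exists_norm_smul_gradient_le {E : Type*} [NormedAddCommGroup E]
    [InnerProductSpace ℝ E] [CompleteSpace E] {g : E → E} (hg : Continuous g)
    (hgc : HasCompactSupport g) (hg0 : g =ᶠ[𝓝 0] 0) :
    ∃ C, 0 ≤ C ∧ ∀ s : ℝ, 0 < s → s ≤ 1 → ∀ y : E,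
      ‖(s * (1 + ‖y‖ ^ 2)) • g (s • y)‖ ≤ C * ‖y‖ := by
  obtain ⟨M, hM⟩ := hg.bounded_above_of_compact_support hgc
  obtain ⟨r, hr, hgr⟩ := Metric.eventually_nhds_iff.1 hg0
  obtain ⟨R, hR⟩ := hgc.isCompact.isBounded.exists_norm_le
  have hM0 : 0 ≤ M := (norm_nonneg _).trans (hM 0)
  have hsupp : ∀ x, g x ≠ 0 → r ≤ ‖x‖ ∧ ‖x‖ ≤ R := fun x hx =>
    ⟨le_of_not_gt fun h => hx (hgr (by simpa using h)), hR x (subset_tsupport _ hx)⟩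
  refine ⟨M / r + M * |R|, by positivity, fun s hs hs1 y => ?_⟩
  by_cases hx : g (s • y) = 0
  · simp only [hx, smul_zero, norm_zero]; positivity
  obtain ⟨h1, h2⟩ := hsupp _ hx
  rw [norm_smul, Real.norm_of_nonneg hs.le] at h1 h2
  rw [norm_smul, Real.norm_of_nonneg (by positivity)]
  have h3 : s ≤ ‖y‖ / r := by
    rw [le_div_iff₀ hr]
    nlinarith [mul_le_mul_of_nonneg_right hs1 (norm_nonneg y)]
  calc s * (1 + ‖y‖ ^ 2) * ‖g (s • y)‖
      ≤ s * (1 + ‖y‖ ^ 2) * M := by gcongr; exact hM _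
    _ = s * M + (s * ‖y‖) * (‖y‖ * M) := by ring
    _ ≤ ‖y‖ / r * M + |R| * (‖y‖ * M) := by
        gcongr; exact h2.trans (le_abs_self R)
    _ = _ := by ring

/-- The weighted energy density of the truncated instanton in the rescaled variable `y = x / s`,
where `s = √ε`, `m = (n - 2) / 2`, and `g` is the gradient of the cut-off. -/
def rescaledDensity {E : Type*} [NormedAddCommGroup E] [NormedSpace ℝ E]
    (β k m : ℝ) (ζ : E → ℝ) (g : E → E) (s : ℝ) (y : E) : ℝ :=
  ‖y‖ ^ β * (ζ (s • y) * (1 + ‖y‖ ^ 2) ^ (-m)) ^ k *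
    ((1 + ‖y‖ ^ 2) ^ (-m - 1) *
      ‖(s * (1 + ‖y‖ ^ 2)) • g (s • y) - (2 * m * ζ (s • y)) • y‖) ^ 2

theorem norm_rpow_mul_profile_eq {E : Type*} [NormedAddCommGroup E] {β k m : ℝ} (hβ : 0 ≤ β)
    (y : E) :
    ‖y‖ ^ β * ((1 + ‖y‖ ^ 2) ^ (-m)) ^ k * ((1 + ‖y‖ ^ 2) ^ (-m - 1) * ‖y‖) ^ 2 =
      ‖y‖ ^ (β + 2) * (1 + ‖y‖ ^ 2) ^ (-(k * m + (2 * m + 2))) := by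
  have hP : 0 < 1 + ‖y‖ ^ 2 := by positivity
  have e1 : (1 + ‖y‖ ^ 2) ^ (-(k * m + (2 * m + 2))) =
      ((1 + ‖y‖ ^ 2) ^ (-m)) ^ k * ((1 + ‖y‖ ^ 2) ^ (-m - 1)) ^ 2 := by
    rw [← Real.rpow_mul hP.le, ← Real.rpow_mul_natCast hP.le, ← Real.rpow_add hP]
    congr 1; push_cast; ring
  have e2 : ‖y‖ ^ (β + 2) = ‖y‖ ^ β * ‖y‖ ^ 2 := by
    rw [Real.rpow_add_of_nonneg (norm_nonneg y) hβ (by norm_num)]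
    norm_cast
  rw [e1, e2]; ring

theorem tendsto_integral_rescaledDensity {E : Type*} [NormedAddCommGroup E]
    [InnerProductSpace ℝ E] [FiniteDimensional ℝ E] [MeasurableSpace E] [BorelSpace E]
    (μ : Measure E) {β k m : ℝ} (hβ : 0 ≤ β) (hk : 0 ≤ k) (hm : 0 ≤ m)
    (hint : Integrable
      (fun y : E => ‖y‖ ^ (β + 2) * (1 + ‖y‖ ^ 2) ^ (-(k * m + (2 * m + 2)))) μ)
    {ζ : E → ℝ} {g : E → E} (hζ : Continuous ζ) (hζ01 : ∀ x, ζ x ∈ Set.Icc (0 : ℝ) 1)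
    (hζ1 : ζ =ᶠ[𝓝 0] fun _ => (1 : ℝ)) (hg : Continuous g) (hgc : HasCompactSupport g)
    (hg0 : g =ᶠ[𝓝 0] 0) :
    Tendsto (fun s => ∫ y, rescaledDensity β k m ζ g s y ∂μ) (𝓝[>] 0)
      (𝓝 ((2 * m) ^ 2 *
        ∫ y : E, ‖y‖ ^ (β + 2) * (1 + ‖y‖ ^ 2) ^ (-(k * m + (2 * m + 2))) ∂μ)) := by
  obtain ⟨C, hC, hgC⟩ := exists_norm_smul_gradient_le hg hgc hg0
  rw [← integral_const_mul]
  refine tendsto_integral_filter_of_dominated_convergence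
    (fun y => (C + 2 * m) ^ 2 *
      (‖y‖ ^ (β + 2) * (1 + ‖y‖ ^ 2) ^ (-(k * m + (2 * m + 2)))))
    (.of_forall fun s => ?_) ?_ (hint.const_mul _) (.of_forall fun y => ?_)
  · have hζm := hζ.measurable
    have hgs : Continuous fun y : E =>
        ‖(s * (1 + ‖y‖ ^ 2)) • g (s • y) - (2 * m * ζ (s • y)) • y‖ := by fun_prop
    have hgm := hgs.measurable
    have hζs : Measurable fun y : E => ζ (s • y) := by fun_prop
    refine Measurable.aestronglyMeasurable ?_
    unfold rescaledDensity
    fun_prop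
  · filter_upwards [Ioc_mem_nhdsGT zero_lt_one] with s hs
    refine .of_forall fun y => ?_
    obtain ⟨hζ0, hζle⟩ := hζ01 (s • y)
    have hP : 0 < 1 + ‖y‖ ^ 2 := by positivity
    have hN : ‖(s * (1 + ‖y‖ ^ 2)) • g (s • y) - (2 * m * ζ (s • y)) • y‖ ≤
        (C + 2 * m) * ‖y‖ := by
      refine (norm_sub_le _ _).trans ?_
      rw [add_mul]
      refine add_le_add (hgC s hs.1 hs.2 y) ?_
      rw [norm_smul, Real.norm_of_nonneg (by positivity)]
      refine mul_le_mul_of_nonneg_right ?_ (norm_nonneg y)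
      exact mul_le_of_le_one_right (by positivity : 0 ≤ 2 * m) hζle
    rw [← norm_rpow_mul_profile_eq hβ, rescaledDensity, Real.norm_of_nonneg (by positivity)]
    calc _ ≤ ‖y‖ ^ β * ((1 + ‖y‖ ^ 2) ^ (-m)) ^ k *
          ((1 + ‖y‖ ^ 2) ^ (-m - 1) * ((C + 2 * m) * ‖y‖)) ^ 2 := by
          gcongr
          exact mul_le_of_le_one_left (by positivity) hζle
      _ = _ := by ring
  · have hs : Tendsto (fun s : ℝ => s • y) (𝓝[>] 0) (𝓝 0) := by
      have : Continuous fun s : ℝ => s • y := by fun_prop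
      simpa using (this.tendsto 0).mono_left nhdsWithin_le_nhds
    refine tendsto_const_nhds.congr' ?_
    filter_upwards [hs.eventually hζ1, hs.eventually hg0] with s h1 h2
    rw [← norm_rpow_mul_profile_eq hβ, rescaledDensity, h1, h2]
    simp only [Pi.zero_apply, smul_zero, zero_sub, norm_neg, norm_smul, one_mul, mul_one]
    rw [Real.norm_of_nonneg (by positivity)]
    ring

theorem energyDensity_smul_eq_rescaledDensity {E : Type*} [NormedAddCommGroup E]
    [InnerProductSpace ℝ E] [CompleteSpace E] {β k m s : ℝ} (hs : 0 < s)
    {ζ : E → ℝ} (hζ0 : ∀ x, 0 ≤ ζ x) (hζ : Differentiable ℝ ζ) {u : E → ℝ}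
    (hu : ∀ x, u x = s ^ m * ζ x * (s ^ 2 + ‖x‖ ^ 2) ^ (-m)) (y : E) :
    ‖s • y‖ ^ β * u (s • y) ^ k * ‖gradient u (s • y)‖ ^ 2 =
      s ^ (β - k * m - (2 * m + 2)) * rescaledDensity β k m ζ (gradient ζ) s y := by
  have hP : 0 < 1 + ‖y‖ ^ 2 := by positivity
  have hw : s ^ 2 + ‖s • y‖ ^ 2 = s ^ 2 * (1 + ‖y‖ ^ 2) := by
    rw [norm_smul, Real.norm_of_nonneg hs.le]; ring
  have hpow : ∀ p : ℝ, (s ^ 2 + ‖s • y‖ ^ 2) ^ p = s ^ (2 * p) * (1 + ‖y‖ ^ 2) ^ p := by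
    intro p
    rw [hw, Real.mul_rpow (by positivity) hP.le, ← Real.rpow_natCast_mul hs.le]
    norm_cast
  have hgrad : gradient u (s • y) =
      (s ^ (-m - 1) * (1 + ‖y‖ ^ 2) ^ (-m - 1)) •
        ((s * (1 + ‖y‖ ^ 2)) • gradient ζ (s • y) - (2 * m * ζ (s • y)) • y) := by
    have h := hasGradientAt_const_mul_mul_rpow (c := s ^ m) (p := -m) (pow_pos hs 2)
      (hζ (s • y)).hasGradientAt
    rw [show u = _ from funext hu, h.gradient, hpow, hpow]
    have e1 : s ^ m * s ^ (2 * -m) = s ^ (-m - 1) * s := by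
      rw [← Real.rpow_add hs, ← Real.rpow_add_one hs.ne']; congr 1; ring
    have e2 : s ^ m * s ^ (2 * (-m - 1)) * s = s ^ (-m - 1) := by
      rw [← Real.rpow_add hs, ← Real.rpow_add_one hs.ne']; congr 1; ring
    have e3 : (1 + ‖y‖ ^ 2) ^ (-m) = (1 + ‖y‖ ^ 2) ^ (-m - 1) * (1 + ‖y‖ ^ 2) := by
      rw [← Real.rpow_add_one hP.ne']; congr 1; ring
    rw [sub_eq_add_neg (_ • gradient ζ _), ← neg_smul, smul_add, smul_add]
    simp only [smul_smul]
    congr 2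
    · rw [e3]
      linear_combination (1 + ‖y‖ ^ 2) ^ (-m - 1) * (1 + ‖y‖ ^ 2) * e1
    · linear_combination -(2 * m * ζ (s • y) * (1 + ‖y‖ ^ 2) ^ (-m - 1)) * e2
  have hval : u (s • y) = s ^ (-m) * (ζ (s • y) * (1 + ‖y‖ ^ 2) ^ (-m)) := by
    have e : s ^ (-m) = s ^ m * s ^ (2 * -m) := by rw [← Real.rpow_add hs]; congr 1; ring
    rw [hu, hpow, e]; ring
  have hexp : s ^ (β - k * m - (2 * m + 2)) = s ^ β * (s ^ (-m)) ^ k * (s ^ (-m - 1)) ^ 2 := by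
    rw [← Real.rpow_mul hs.le, ← Real.rpow_mul_natCast hs.le, ← Real.rpow_add hs,
      ← Real.rpow_add hs]
    congr 1; push_cast; ring
  rw [hgrad, hval, hexp, rescaledDensity, norm_smul, norm_smul, Real.norm_of_nonneg hs.le,
    Real.norm_of_nonneg (by positivity : 0 ≤ s ^ (-m - 1) * (1 + ‖y‖ ^ 2) ^ (-m - 1)),
    Real.mul_rpow hs.le (norm_nonneg y),
    Real.mul_rpow (by positivity) (mul_nonneg (hζ0 _) (by positivity))]
  ring

/-- For `kn/q = k(n-2)/2 < β < (k+1)(n-2)`, the weighted Dirichlet energy of the instanton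
satisfies `∫_Ω |x|^β u_ε^k |∇u_ε|² = C ε^{(2β-k(n-2))/4} + o(ε^{(2β-k(n-2))/4})`, where
`C = (n-2)² ∫_{ℝⁿ} |y|^{β+2}(1+|y|²)^{-(k(n-2)/2+n)} dy` is a finite positive constant. -/
theorem stmt_5 (n : ℕ) (hn : 3 ≤ n) (q : ℝ) (hq : q = 2 * n / (n - 2))
    (Ω : Set (EuclideanSpace ℝ (Fin n))) (hΩo : IsOpen Ω)
    (hΩb : Bornology.IsBounded Ω) (h0 : 0 ∈ Ω)
    (β k : ℝ) (hk0 : 0 < k) (hkq : k ≤ q)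
    (hβ1 : k * (n - 2) / 2 < β) (hβ2 : β < (k + 1) * (n - 2))
    (ζ : EuclideanSpace ℝ (Fin n) → ℝ) (hζs : ContDiff ℝ (⊤ : ℕ∞) ζ)
    (hζc : HasCompactSupport ζ) (hζΩ : tsupport ζ ⊆ Ω)
    (hζ01 : ∀ x, ζ x ∈ Set.Icc (0:ℝ) 1) (hζ1 : ζ =ᶠ[𝓝 0] fun _ => (1:ℝ))
    (u : ℝ → EuclideanSpace ℝ (Fin n) → ℝ)
    (hu : ∀ ε x, u ε x = ε ^ ((n - 2 : ℝ)/4) * ζ x * (ε + ‖x‖ ^ 2) ^ (-((n : ℝ) - 2)/2)) :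
    Integrable (fun y : EuclideanSpace ℝ (Fin n) =>
        ‖y‖ ^ (β + 2) * (1 + ‖y‖ ^ 2) ^ (-(k * ((n : ℝ) - 2) / 2 + n))) ∧
    0 < ((n : ℝ) - 2) ^ 2 * (∫ y : EuclideanSpace ℝ (Fin n),
        ‖y‖ ^ (β + 2) * (1 + ‖y‖ ^ 2) ^ (-(k * ((n : ℝ) - 2) / 2 + n))) ∧
    Tendsto (fun ε =>
        (∫ x in Ω, ‖x‖ ^ β * u ε x ^ k * ‖gradient (u ε) x‖ ^ 2) /
          ε ^ ((2 * β - k * ((n : ℝ) - 2)) / 4))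
      (𝓝[>] 0)
      (𝓝 (((n : ℝ) - 2) ^ 2 * ∫ y : EuclideanSpace ℝ (Fin n),
        ‖y‖ ^ (β + 2) * (1 + ‖y‖ ^ 2) ^ (-(k * ((n : ℝ) - 2) / 2 + n)))) := by
  have hn3 : (3 : ℝ) ≤ n := by exact_mod_cast hn
  set m : ℝ := ((n : ℝ) - 2) / 2 with hm
  have hm0 : 0 < m := by rw [hm]; linarith
  have hnm : (n : ℝ) = 2 * m + 2 := by rw [hm]; ring
  have hβ0 : 0 ≤ β := by nlinarith
  have hexp : -(k * ((n : ℝ) - 2) / 2 + n) = -(k * m + (2 * m + 2)) := by rw [hm]; ring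
  have hconst : ((n : ℝ) - 2) ^ 2 = (2 * m) ^ 2 := by rw [hm]; ring
  rw [hexp, hconst]
  have hint : Integrable (fun y : EuclideanSpace ℝ (Fin n) =>
      ‖y‖ ^ (β + 2) * (1 + ‖y‖ ^ 2) ^ (-(k * m + (2 * m + 2)))) := by
    refine integrable_norm_rpow_mul_one_add_norm_sq_rpow _ (by linarith) ?_
    rw [finrank_euclideanSpace_fin]
    nlinarith
  refine ⟨hint, ?_, ?_⟩
  · refine mul_pos (by positivity) ?_
    have : NeZero n := ⟨by omega⟩
    refine integral_pos_of_integrable_nonneg_nonzero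
      (x := EuclideanSpace.single (0 : Fin n) (1 : ℝ)) ?_ hint (fun y => by positivity) ?_
    · refine Continuous.mul (continuous_norm.rpow_const fun _ => Or.inr (by linarith)) ?_
      exact Continuous.rpow_const (by fun_prop) fun y => Or.inl (by positivity)
    · simp only [PiLp.norm_single, norm_one, Real.one_rpow, one_mul]
      positivity
  have hζd : Differentiable ℝ ζ := hζs.differentiable (by simp)
  have hg : Continuous (gradient ζ) :=
    (InnerProductSpace.toDual ℝ _).symm.continuous.comp (hζs.continuous_fderiv (by simp))
  have hgc : HasCompactSupport (gradient ζ) :=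
    (hζc.fderiv (𝕜 := ℝ)).comp_left (map_zero _)
  have hg0 : gradient ζ =ᶠ[𝓝 0] 0 := by
    filter_upwards [hζ1.eventuallyEq_nhds] with x hx
    rw [hx.gradient_eq]
    simp
  have hsqrt : Tendsto Real.sqrt (𝓝[>] 0) (𝓝[>] 0) := by
    refine tendsto_nhdsWithin_iff.2 ⟨?_, ?_⟩
    · simpa using (Real.continuous_sqrt.tendsto 0).mono_left nhdsWithin_le_nhds
    · filter_upwards [self_mem_nhdsWithin] with ε hε using Real.sqrt_pos.2 hε
  refine ((tendsto_integral_rescaledDensity volume hβ0 hk0.le hm0.le hint hζs.continuous hζ01 hζ1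
    hg hgc hg0).comp hsqrt).congr' ?_
  filter_upwards [self_mem_nhdsWithin] with ε hε
  have hε : 0 < ε := hε
  obtain ⟨s, hs, rfl⟩ : ∃ s : ℝ, 0 < s ∧ s ^ 2 = ε :=
    ⟨√ε, Real.sqrt_pos.2 hε, Real.sq_sqrt hε.le⟩
  have hus : ∀ x, u (s ^ 2) x = s ^ m * ζ x * (s ^ 2 + ‖x‖ ^ 2) ^ (-m) := by
    intro x
    rw [hu, ← Real.rpow_natCast_mul hs.le]
    congr 2 <;> congr 1 <;> rw [hm] <;> push_cast <;> ring
  rw [Function.comp_apply, Real.sqrt_sq hs.le, setIntegral_eq_integral_of_forall_compl_eq_zero]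
  · have hscale := Measure.integral_comp_smul (volume : Measure (EuclideanSpace ℝ (Fin n)))
      (fun x => ‖x‖ ^ β * u (s ^ 2) x ^ k * ‖gradient (u (s ^ 2)) x‖ ^ 2) s
    simp only [energyDensity_smul_eq_rescaledDensity hs (fun x => (hζ01 x).1) hζd hus,
      integral_const_mul, finrank_euclideanSpace_fin, smul_eq_mul] at hscale
    have hsn : s ^ n = s ^ (2 * m + 2) := by rw [← hnm, Real.rpow_natCast]
    rw [abs_of_pos (by positivity), hsn, Real.rpow_sub hs] at hscale
    have hden : (s ^ 2) ^ ((2 * β - k * ((n : ℝ) - 2)) / 4) = s ^ (β - k * m) := by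
      rw [← Real.rpow_natCast_mul hs.le, hm]; congr 1; push_cast; ring
    rw [hden, eq_div_iff (by positivity)]
    field_simp at hscale
    linarith
  · intro x hx
    have : ζ x = 0 := image_eq_zero_of_notMem_tsupport fun h => hx (hζΩ h)
    rw [hu, this]
    simp [Real.zero_rpow hk0.ne']

end
end

section
/- Suppose 0 < k ≤ q and β = (k+1)(n−2). Then, as ε → 0⁺, ∫_Ω |x|^β u_ε(x)^k |∇u_ε(x)|² dx = O( ε^{(k+2)(n−2)/4} |log ε| ). -/
open MeasureTheory Filter Topology Set

noncomputable section

open Asymptotics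

/-- Polar coordinates bound the integral of `(ε + |x|²)^{-n/2}` over a ball by a logarithm. -/
theorem setIntegral_closedBall_rpow_le {n : ℕ} (hn : 2 ≤ n) {R ε : ℝ} (hR : 0 ≤ R) (hε : 0 < ε) :
    ∫ x in Metric.closedBall (0 : EuclideanSpace ℝ (Fin n)) R, (ε + ‖x‖ ^ 2) ^ (-(n : ℝ) / 2) ≤
      n * volume.real (Metric.ball (0 : EuclideanSpace ℝ (Fin n)) 1) *
        ((Real.log (ε + R ^ 2) - Real.log ε) / 2) := by
  have hcont : Continuous fun y : ℝ => y * (ε + y ^ 2)⁻¹ :=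
    continuous_id.mul ((by fun_prop : Continuous fun y : ℝ => ε + y ^ 2).inv₀
      fun y => by positivity)
  have hFTC : ∫ y in (0 : ℝ)..R, y * (ε + y ^ 2)⁻¹ =
      (Real.log (ε + R ^ 2) - Real.log ε) / 2 := by
    have hderiv : ∀ y ∈ uIcc 0 R,
        HasDerivAt (fun y : ℝ => Real.log (ε + y ^ 2) / 2) (y * (ε + y ^ 2)⁻¹) y := by
      intro y _
      have hne : ε + y ^ 2 ≠ 0 := by positivity
      refine ((((hasDerivAt_pow 2 y).const_add ε).log hne).div_const 2).congr_deriv ?_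
      push_cast
      field_simp
    rw [intervalIntegral.integral_eq_sub_of_hasDerivAt hderiv (hcont.intervalIntegrable _ _)]
    simp
    ring
  let f : ℝ → ℝ := (Iic R).indicator fun y => (ε + y ^ 2) ^ (-(n : ℝ) / 2)
  have hf : ∫ x in Metric.closedBall (0 : EuclideanSpace ℝ (Fin n)) R,
      (ε + ‖x‖ ^ 2) ^ (-(n : ℝ) / 2) = ∫ x : EuclideanSpace ℝ (Fin n), f ‖x‖ := by
    rw [← integral_indicator Metric.isClosed_closedBall.measurableSet]
    congr 1
    ext x
    simp [f, indicator]
  have : Nontrivial (EuclideanSpace ℝ (Fin n)) :=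
    Module.nontrivial_of_finrank_pos (R := ℝ) (by simp; omega)
  rw [hf, integral_fun_norm_addHaar volume f, finrank_euclideanSpace_fin, nsmul_eq_mul,
    smul_eq_mul, mul_assoc]
  have hmain : ∫ y in Ioi (0 : ℝ), y ^ (n - 1) • f y ≤
      (Real.log (ε + R ^ 2) - Real.log ε) / 2 := by
    rw [← hFTC, intervalIntegral.integral_of_le hR, ← Ioi_inter_Iic,
      ← setIntegral_indicator measurableSet_Iic]
    refine integral_mono_of_nonneg ?_ ?_ ?_
    · filter_upwards [ae_restrict_mem measurableSet_Ioi] with y hy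
      have hy : 0 < y := hy
      simp only [f, indicator, Pi.zero_apply, smul_eq_mul]
      split_ifs <;> positivity
    · rw [integrable_indicator_iff measurableSet_Iic, IntegrableOn,
        Measure.restrict_restrict measurableSet_Iic, inter_comm, Ioi_inter_Iic]
      exact (hcont.intervalIntegrable 0 R).1
    · filter_upwards [ae_restrict_mem measurableSet_Ioi] with y hy
      have hy : 0 < y := hy
      simp only [f, indicator, smul_eq_mul]
      split_ifs
      · obtain ⟨m, rfl⟩ := Nat.exists_eq_add_of_le' hn
        have hs : 0 < ε + y ^ 2 := by positivity
        have hpow : y ^ m ≤ (ε + y ^ 2) ^ ((m : ℝ) / 2) := by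
          rw [show y ^ m = (y ^ 2) ^ ((m : ℝ) / 2) by
            rw [← Real.rpow_natCast y 2, ← Real.rpow_mul hy.le, ← Real.rpow_natCast y m]
            congr 1
            push_cast
            ring]
          gcongr
          linarith
        calc y ^ (m + 2 - 1) * (ε + y ^ 2) ^ (-((m + 2 : ℕ) : ℝ) / 2)
            = y * y ^ m * (ε + y ^ 2) ^ (-((m + 2 : ℕ) : ℝ) / 2) := by
              rw [show m + 2 - 1 = m + 1 by omega, pow_succ, mul_comm y]
          _ ≤ y * (ε + y ^ 2) ^ ((m : ℝ) / 2) * (ε + y ^ 2) ^ (-((m + 2 : ℕ) : ℝ) / 2) := by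
              gcongr
          _ = y * (ε + y ^ 2)⁻¹ := by
              rw [mul_assoc, ← Real.rpow_add hs, ← Real.rpow_neg_one]
              congr 2
              push_cast
              ring
      · simp
  gcongr

/-- Gradient of a cut-off multiplied by a power of `ε + |x|²`, when the gradient of the
cut-off vanishes linearly at the origin. -/
theorem norm_gradient_cutoff_mul_rpow_le {E : Type*} [NormedAddCommGroup E]
    [InnerProductSpace ℝ E] [CompleteSpace E] {ζ : E → ℝ} {a C S ε m : ℝ} {x : E}
    (hζ : DifferentiableAt ℝ ζ x) (hζ01 : ζ x ∈ Icc (0 : ℝ) 1)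
    (hC : ‖fderiv ℝ ζ x‖ ≤ C * ‖x‖) (hC0 : 0 ≤ C) (ha : 0 ≤ a) (hm : 0 ≤ m) (hε : 0 < ε)
    (hS : ε + ‖x‖ ^ 2 ≤ S) :
    ‖gradient (fun y => a * ζ y * (ε + ‖y‖ ^ 2) ^ (-m / 2)) x‖ ≤
      (C * S + m) * a * (ε + ‖x‖ ^ 2) ^ (-(m + 1) / 2) := by
  have hs : 0 < ε + ‖x‖ ^ 2 := by positivity
  have hxs : ‖x‖ ≤ (ε + ‖x‖ ^ 2) ^ (1 / 2 : ℝ) := by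
    rw [← Real.sqrt_eq_rpow]
    exact Real.le_sqrt_of_sq_le (by linarith)
  have hnorm : HasFDerivAt (fun y : E => ε + ‖y‖ ^ 2) (2 • innerSL ℝ x) x :=
    (hasStrictFDerivAt_norm_sq x).hasFDerivAt.const_add ε
  have hderiv := (hζ.hasFDerivAt.const_mul a).mul
    (hnorm.rpow_const (p := -m / 2) (Or.inl hs.ne'))
  rw [gradient, LinearIsometryEquiv.norm_map]
  refine (congrArg norm hderiv.fderiv).trans_le ((norm_add_le _ _).trans ?_)
  have hinner : ‖(2 • innerSL ℝ x : E →L[ℝ] ℝ)‖ ≤ 2 * ‖x‖ := by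
    rw [two_smul]
    refine (norm_add_le _ _).trans ?_
    rw [innerSL_apply_norm]
    linarith
  have h1 : ‖(a * ζ x) • ((-m / 2 * (ε + ‖x‖ ^ 2) ^ (-m / 2 - 1)) • (2 • innerSL ℝ x))‖ ≤
      m * a * (ε + ‖x‖ ^ 2) ^ (-(m + 1) / 2) := by
    rw [norm_smul, norm_smul, norm_mul, norm_mul, Real.norm_of_nonneg ha,
      Real.norm_of_nonneg hζ01.1, Real.norm_of_nonneg (Real.rpow_nonneg hs.le _),
      show ‖-m / 2‖ = m / 2 by rw [neg_div, norm_neg, Real.norm_of_nonneg (by positivity)]]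
    calc a * ζ x * (m / 2 * (ε + ‖x‖ ^ 2) ^ (-m / 2 - 1) * ‖(2 • innerSL ℝ x : E →L[ℝ] ℝ)‖)
        ≤ a * 1 * (m / 2 * (ε + ‖x‖ ^ 2) ^ (-m / 2 - 1) *
            (2 * (ε + ‖x‖ ^ 2) ^ (1 / 2 : ℝ))) := by
          gcongr
          · exact hζ01.2
          · exact hinner.trans (by gcongr)
      _ = m * a * ((ε + ‖x‖ ^ 2) ^ (-m / 2 - 1) * (ε + ‖x‖ ^ 2) ^ (1 / 2 : ℝ)) := by ring
      _ = m * a * (ε + ‖x‖ ^ 2) ^ (-(m + 1) / 2) := by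
          rw [← Real.rpow_add hs]
          congr 2
          ring
  have h2 : ‖((ε + ‖x‖ ^ 2) ^ (-m / 2)) • (a • fderiv ℝ ζ x)‖ ≤
      C * S * a * (ε + ‖x‖ ^ 2) ^ (-(m + 1) / 2) := by
    rw [norm_smul, norm_smul, Real.norm_of_nonneg ha,
      Real.norm_of_nonneg (Real.rpow_nonneg hs.le _)]
    calc (ε + ‖x‖ ^ 2) ^ (-m / 2) * (a * ‖fderiv ℝ ζ x‖)
        ≤ (ε + ‖x‖ ^ 2) ^ (-m / 2) * (a * (C * (ε + ‖x‖ ^ 2) ^ (1 / 2 : ℝ))) := by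
          gcongr
          exact hC.trans (by gcongr)
      _ = C * a * ((ε + ‖x‖ ^ 2) ^ (-m / 2) * (ε + ‖x‖ ^ 2) ^ (1 / 2 : ℝ)) := by ring
      _ = C * (ε + ‖x‖ ^ 2) * a * (ε + ‖x‖ ^ 2) ^ (-(m + 1) / 2) := by
          rw [← Real.rpow_add hs, show -m / 2 + 1 / 2 = 1 + -(m + 1) / 2 by ring,
            Real.rpow_add hs, Real.rpow_one]
          ring
      _ ≤ C * S * a * (ε + ‖x‖ ^ 2) ^ (-(m + 1) / 2) := by gcongr
  linarith

/-- Pointwise bound of the borderline weighted energy density. -/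
theorem weighted_density_le {β k m r s e z g K : ℝ} (hk : 0 ≤ k) (hm : 0 ≤ m)
    (hβ : β = (k + 1) * m) (hr : 0 ≤ r) (hs : 0 < s) (hrs : r ^ 2 ≤ s) (he : 0 < e)
    (hz : z ∈ Icc (0 : ℝ) 1) (hg0 : 0 ≤ g)
    (hg : g ≤ K * e ^ (m / 4) * s ^ (-(m + 1) / 2)) :
    r ^ β * (e ^ (m / 4) * z * s ^ (-m / 2)) ^ k * g ^ 2 ≤
      K ^ 2 * e ^ ((k + 2) * m / 4) * s ^ (-(m + 2) / 2) := by
  have hβ0 : 0 ≤ β := by rw [hβ]; positivity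
  have hrβ : r ^ β ≤ s ^ (β / 2) := by
    rw [show r ^ β = (r ^ 2) ^ (β / 2) by
      rw [← Real.rpow_natCast r 2, ← Real.rpow_mul hr]
      congr 1
      push_cast
      ring]
    gcongr
  have hz0 := hz.1
  calc r ^ β * (e ^ (m / 4) * z * s ^ (-m / 2)) ^ k * g ^ 2
      ≤ s ^ (β / 2) * (e ^ (m / 4) * 1 * s ^ (-m / 2)) ^ k *
          (K * e ^ (m / 4) * s ^ (-(m + 1) / 2)) ^ 2 := by
        gcongr
        exact hz.2
    _ = K ^ 2 * (e ^ (m / 4 * k) * e ^ (m / 4) * e ^ (m / 4)) *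
          (s ^ (β / 2) * s ^ (-m / 2 * k) * s ^ (-(m + 1) / 2) * s ^ (-(m + 1) / 2)) := by
        rw [mul_one, Real.mul_rpow (by positivity) (by positivity), ← Real.rpow_mul he.le,
          ← Real.rpow_mul hs.le]
        ring
    _ = K ^ 2 * e ^ ((k + 2) * m / 4) * s ^ (-(m + 2) / 2) := by
        simp only [← Real.rpow_add he, ← Real.rpow_add hs]
        rw [hβ]
        congr 2
        · congr 1
          ring
        · ring

/-- Borderline case `β = (k+1)(n-2)`:
`∫_Ω |x|^β u_ε^k |∇u_ε|² = O(ε^{(k+2)(n-2)/4} |log ε|)` as `ε → 0⁺`. -/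
theorem stmt_6 (n : ℕ) (hn : 3 ≤ n) (q : ℝ) (hq : q = 2 * n / (n - 2))
    (Ω : Set (EuclideanSpace ℝ (Fin n))) (hΩo : IsOpen Ω)
    (hΩb : Bornology.IsBounded Ω) (h0 : 0 ∈ Ω)
    (β k : ℝ) (hk0 : 0 < k) (hkq : k ≤ q) (hβ : β = (k + 1) * (n - 2))
    (ζ : EuclideanSpace ℝ (Fin n) → ℝ) (hζs : ContDiff ℝ (⊤ : ℕ∞) ζ)
    (hζc : HasCompactSupport ζ) (hζΩ : tsupport ζ ⊆ Ω)
    (hζ01 : ∀ x, ζ x ∈ Set.Icc (0:ℝ) 1) (hζ1 : ζ =ᶠ[𝓝 0] fun _ => (1:ℝ))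
    (u : ℝ → EuclideanSpace ℝ (Fin n) → ℝ)
    (hu : ∀ ε x, u ε x = ε ^ ((n - 2 : ℝ)/4) * ζ x * (ε + ‖x‖ ^ 2) ^ (-((n : ℝ) - 2)/2)) :
    (fun ε => ∫ x in Ω, ‖x‖ ^ β * u ε x ^ k * ‖gradient (u ε) x‖ ^ 2)
      =O[𝓝[>] 0]
    (fun ε => ε ^ ((k + 2) * ((n : ℝ) - 2) / 4) * |Real.log ε|) := by
  have hn2 : (0 : ℝ) ≤ (n : ℝ) - 2 := by
    have : (3 : ℝ) ≤ n := by exact_mod_cast hn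
    linarith
  obtain ⟨R, hR0, hΩR⟩ := hΩb.subset_closedBall_lt 0 (0 : EuclideanSpace ℝ (Fin n))
  obtain ⟨L, hL⟩ := ContDiff.lipschitzWith_of_hasCompactSupport (𝕂 := ℝ)
    (hζc.fderiv (𝕜 := ℝ)) (hζs.fderiv_right (m := 1) (by norm_cast)) one_ne_zero
  have hfd0 : fderiv ℝ ζ 0 = 0 := by rw [hζ1.fderiv_eq]; simp
  have hfd : ∀ x, ‖fderiv ℝ ζ x‖ ≤ L * ‖x‖ := fun x => by
    simpa [dist_eq_norm, hfd0] using hL.dist_le_mul x 0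
  set S : ℝ := 1 + R ^ 2 with hS
  set K : ℝ := L * S + ((n : ℝ) - 2) with hK
  set V : ℝ := n * volume.real (Metric.ball (0 : EuclideanSpace ℝ (Fin n)) 1) with hV
  have hV0 : 0 ≤ V := by positivity
  have hlogS : 0 ≤ Real.log S := Real.log_nonneg (by nlinarith)
  refine IsBigO.of_bound (K ^ 2 * V * (Real.log S + 1)) ?_
  filter_upwards [Ioo_mem_nhdsGT (Real.exp_pos (-1))] with ε ⟨hε, hε1⟩
  have hlog : Real.log ε < -1 := by rwa [Real.log_lt_iff_lt_exp hε]
  have hεlt : ε < 1 := hε1.trans (by simp)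
  have hu0 : ∀ x, 0 ≤ u ε x := fun x => by
    rw [hu]
    have := (hζ01 x).1
    positivity
  have hpt : ∀ x ∈ Ω, ‖x‖ ^ β * u ε x ^ k * ‖gradient (u ε) x‖ ^ 2 ≤
      K ^ 2 * ε ^ ((k + 2) * ((n : ℝ) - 2) / 4) * (ε + ‖x‖ ^ 2) ^ (-(n : ℝ) / 2) := by
    intro x hx
    have hxR : ‖x‖ ≤ R := by simpa using hΩR hx
    have hgrad := norm_gradient_cutoff_mul_rpow_le (a := ε ^ (((n : ℝ) - 2) / 4))
      (S := S) (m := (n : ℝ) - 2) (hζs.differentiable (by simp) x) (hζ01 x) (hfd x) L.2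
      (by positivity) hn2 hε (by rw [hS]; gcongr)
    rw [← show u ε = _ from funext (hu ε)] at hgrad
    have := weighted_density_le hk0.le hn2 hβ (norm_nonneg x)
      (by positivity : 0 < ε + ‖x‖ ^ 2) (by linarith) hε (hζ01 x) (norm_nonneg _) hgrad
    rwa [← hu, sub_add_cancel] at this
  have hnonneg : ∀ x, 0 ≤ ‖x‖ ^ β * u ε x ^ k * ‖gradient (u ε) x‖ ^ 2 := fun x => by
    have := hu0 x
    positivity
  have hcont : Continuous fun x : EuclideanSpace ℝ (Fin n) =>
      (ε + ‖x‖ ^ 2) ^ (-(n : ℝ) / 2) :=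
    (by fun_prop : Continuous fun x : EuclideanSpace ℝ (Fin n) => ε + ‖x‖ ^ 2).rpow_const
      fun x => Or.inl (by positivity)
  have hint : IntegrableOn (fun x : EuclideanSpace ℝ (Fin n) =>
      (ε + ‖x‖ ^ 2) ^ (-(n : ℝ) / 2)) (Metric.closedBall 0 R) :=
    hcont.continuousOn.integrableOn_compact (isCompact_closedBall _ _)
  have hlogle : (Real.log (ε + R ^ 2) - Real.log ε) / 2 ≤ (Real.log S + 1) * |Real.log ε| := by
    have : Real.log (ε + R ^ 2) ≤ Real.log S :=
      Real.log_le_log (by positivity) (by rw [hS]; linarith)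
    rw [abs_of_neg (by linarith)]
    nlinarith
  rw [Real.norm_of_nonneg (integral_nonneg hnonneg), Real.norm_of_nonneg (by positivity)]
  calc ∫ x in Ω, ‖x‖ ^ β * u ε x ^ k * ‖gradient (u ε) x‖ ^ 2
      ≤ ∫ x in Ω, K ^ 2 * ε ^ ((k + 2) * ((n : ℝ) - 2) / 4) *
          (ε + ‖x‖ ^ 2) ^ (-(n : ℝ) / 2) :=
        integral_mono_of_nonneg (ae_of_all _ hnonneg) ((hint.mono_set hΩR).const_mul _)
          ((ae_restrict_mem hΩo.measurableSet).mono hpt)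
    _ = K ^ 2 * ε ^ ((k + 2) * ((n : ℝ) - 2) / 4) *
          ∫ x in Ω, (ε + ‖x‖ ^ 2) ^ (-(n : ℝ) / 2) := integral_const_mul _ _
    _ ≤ K ^ 2 * ε ^ ((k + 2) * ((n : ℝ) - 2) / 4) *
          ∫ x in Metric.closedBall (0 : EuclideanSpace ℝ (Fin n)) R,
            (ε + ‖x‖ ^ 2) ^ (-(n : ℝ) / 2) := by
        refine mul_le_mul_of_nonneg_left ?_ (by positivity)
        exact setIntegral_mono_set hint (ae_of_all _ fun x => by positivity) hΩR.eventuallyLE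
    _ ≤ K ^ 2 * ε ^ ((k + 2) * ((n : ℝ) - 2) / 4) *
          (V * ((Real.log S + 1) * |Real.log ε|)) := by
        gcongr
        exact (setIntegral_closedBall_rpow_le (by omega) hR0.le hε).trans (by gcongr)
    _ = _ := by ring

end
end

section
/- Suppose 0 < k ≤ q and β > (k+1)(n−2). Then, as ε → 0⁺, ∫_Ω |x|^β u_ε(x)^k |∇u_ε(x)|² dx = O( ε^{(k+2)(n−2)/4} ). -/
open MeasureTheory Filter Topology Set

noncomputable section

open Asymptotics

/-- `‖x‖ ^ s` is integrable on balls around the origin of `ℝⁿ` for `s > -n`. -/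
theorem integrableOn_ball_norm_rpow {n : ℕ} (hn : 1 ≤ n) {s R : ℝ} (hR : 0 < R)
    (hs : -(n : ℝ) < s) :
    IntegrableOn (fun x : EuclideanSpace ℝ (Fin n) => ‖x‖ ^ s) (Metric.ball 0 R) := by
  have : Nonempty (Fin n) := ⟨⟨0, hn⟩⟩
  rw [integrableOn_fun_norm_addHaar volume (f := fun r : ℝ => r ^ s)]
  have h : IntegrableOn (fun r : ℝ => r ^ (s + (n - 1))) (Ioo 0 R) :=
    (intervalIntegral.integrableOn_Ioo_rpow_iff hR).2 (by linarith)
  refine h.congr_fun (fun r hr => ?_) measurableSet_Ioo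
  have hr0 : 0 < r := hr.1
  simp only [finrank_euclideanSpace, Fintype.card_fin, smul_eq_mul]
  rw [← Real.rpow_natCast, ← Real.rpow_add hr0, Nat.cast_sub hn, Nat.cast_one, add_comm]

/-- Bound, uniform in `ε`, for the gradient of the truncated bubble `c ζ (ε + |x|²) ^ (-m)` away
from the origin. -/
theorem norm_gradient_bubble_le {n : ℕ} {ζ : EuclideanSpace ℝ (Fin n) → ℝ}
    (hζ : Differentiable ℝ ζ) {x : EuclideanSpace ℝ (Fin n)} (hx : x ≠ 0)
    (hζ01 : ζ x ∈ Set.Icc (0 : ℝ) 1) {C R : ℝ} (hC : ‖fderiv ℝ ζ x‖ ≤ C) (hxR : ‖x‖ ≤ R)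
    {c ε m : ℝ} (hc : 0 ≤ c) (hε : 0 < ε) (hm : 0 ≤ m) :
    ‖gradient (fun y => c * ζ y * (ε + ‖y‖ ^ 2) ^ (-m)) x‖
      ≤ c * ((C * R + 2 * m) * ‖x‖ ^ (-(2 * m) - 1)) := by
  have hx0 : 0 < ‖x‖ := norm_pos_iff.2 hx
  have hpow : ∀ p : ℝ, 0 ≤ p → (ε + ‖x‖ ^ 2) ^ (-p) ≤ ‖x‖ ^ (-(2 * p)) := by
    intro p hp
    calc (ε + ‖x‖ ^ 2) ^ (-p) ≤ (‖x‖ ^ 2) ^ (-p) :=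
          Real.rpow_le_rpow_of_nonpos (by positivity) (by linarith) (by linarith)
      _ = ‖x‖ ^ (-(2 * p)) := by
          rw [← Real.rpow_natCast, ← Real.rpow_mul hx0.le]
          congr 1
          push_cast
          ring
  have hbase : HasFDerivAt (fun y : EuclideanSpace ℝ (Fin n) => ε + ‖y‖ ^ 2)
      (2 • innerSL ℝ x) x := (hasStrictFDerivAt_norm_sq x).hasFDerivAt.const_add ε
  have hrpow := hbase.rpow_const (p := -m) (Or.inl (by positivity))
  have hu := ((hζ x).hasFDerivAt.const_mul c).mul hrpow
  have hgrad : ‖gradient (fun y => c * ζ y * (ε + ‖y‖ ^ 2) ^ (-m)) x‖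
      = ‖fderiv ℝ (fun y => c * ζ y * (ε + ‖y‖ ^ 2) ^ (-m)) x‖ :=
    LinearIsometryEquiv.norm_map _ _
  have h1 : (ε + ‖x‖ ^ 2) ^ (-m) ≤ R * ‖x‖ ^ (-(2 * m) - 1) :=
    calc (ε + ‖x‖ ^ 2) ^ (-m) ≤ ‖x‖ ^ (-(2 * m)) := hpow m hm
      _ = ‖x‖ * ‖x‖ ^ (-(2 * m) - 1) := by
          rw [Real.rpow_sub_one hx0.ne']
          field_simp
      _ ≤ R * ‖x‖ ^ (-(2 * m) - 1) := by gcongr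
  have h2 : (ε + ‖x‖ ^ 2) ^ (-m - 1) * ‖x‖ ≤ ‖x‖ ^ (-(2 * m) - 1) :=
    calc (ε + ‖x‖ ^ 2) ^ (-m - 1) * ‖x‖ = (ε + ‖x‖ ^ 2) ^ (-(m + 1)) * ‖x‖ := by ring_nf
      _ ≤ ‖x‖ ^ (-(2 * (m + 1))) * ‖x‖ := by
          gcongr
          exact hpow _ (by linarith)
      _ = ‖x‖ ^ (-(2 * m) - 1) := by
          rw [← Real.rpow_add_one hx0.ne']
          ring_nf
  have hA : 0 ≤ (ε + ‖x‖ ^ 2) ^ (-m) := by positivity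
  have hB : 0 ≤ (ε + ‖x‖ ^ 2) ^ (-m - 1) := by positivity
  have hC0 : 0 ≤ C := (norm_nonneg _).trans hC
  rw [hgrad, show fderiv ℝ (fun y => c * ζ y * (ε + ‖y‖ ^ 2) ^ (-m)) x = _ from hu.fderiv]
  refine (norm_add_le _ _).trans ?_
  have e1 : ‖(c * ζ x) • ((-m * (ε + ‖x‖ ^ 2) ^ (-m - 1)) • (2 • innerSL ℝ x))‖
      = c * (ζ x * (2 * m * ((ε + ‖x‖ ^ 2) ^ (-m - 1) * ‖x‖))) := by
    rw [two_nsmul, ← two_smul ℝ, norm_smul, norm_smul, norm_smul, innerSL_apply_norm,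
      norm_mul, norm_mul, norm_neg, Real.norm_of_nonneg hc, Real.norm_of_nonneg hζ01.1,
      Real.norm_of_nonneg hm, Real.norm_of_nonneg hB, Real.norm_ofNat]
    ring
  have e2 : ‖((ε + ‖x‖ ^ 2) ^ (-m)) • (c • fderiv ℝ ζ x)‖
      = c * (‖fderiv ℝ ζ x‖ * (ε + ‖x‖ ^ 2) ^ (-m)) := by
    rw [norm_smul, norm_smul, Real.norm_of_nonneg hc, Real.norm_of_nonneg hA]
    ring
  rw [e1, e2, ← mul_add]
  refine mul_le_mul_of_nonneg_left ?_ hc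
  have b1 : ζ x * (2 * m * ((ε + ‖x‖ ^ 2) ^ (-m - 1) * ‖x‖))
      ≤ 1 * (2 * m * ‖x‖ ^ (-(2 * m) - 1)) := by
    gcongr
    exact hζ01.2
  have b2 : ‖fderiv ℝ ζ x‖ * (ε + ‖x‖ ^ 2) ^ (-m) ≤ C * (R * ‖x‖ ^ (-(2 * m) - 1)) := by
    gcongr
  linarith

/-- Case `β > (k+1)(n-2)`:
`∫_Ω |x|^β u_ε^k |∇u_ε|² = O(ε^{(k+2)(n-2)/4})` as `ε → 0⁺`. -/
theorem stmt_7 (n : ℕ) (hn : 3 ≤ n) (q : ℝ) (hq : q = 2 * n / (n - 2))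
    (Ω : Set (EuclideanSpace ℝ (Fin n))) (hΩo : IsOpen Ω)
    (hΩb : Bornology.IsBounded Ω) (h0 : 0 ∈ Ω)
    (β k : ℝ) (hk0 : 0 < k) (hkq : k ≤ q) (hβ : β > (k + 1) * (n - 2))
    (ζ : EuclideanSpace ℝ (Fin n) → ℝ) (hζs : ContDiff ℝ (⊤ : ℕ∞) ζ)
    (hζc : HasCompactSupport ζ) (hζΩ : tsupport ζ ⊆ Ω)
    (hζ01 : ∀ x, ζ x ∈ Set.Icc (0:ℝ) 1) (hζ1 : ζ =ᶠ[𝓝 0] fun _ => (1:ℝ))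
    (u : ℝ → EuclideanSpace ℝ (Fin n) → ℝ)
    (hu : ∀ ε x, u ε x = ε ^ ((n - 2 : ℝ)/4) * ζ x * (ε + ‖x‖ ^ 2) ^ (-((n : ℝ) - 2)/2)) :
    (fun ε => ∫ x in Ω, ‖x‖ ^ β * u ε x ^ k * ‖gradient (u ε) x‖ ^ 2)
      =O[𝓝[>] 0]
    (fun ε => ε ^ ((k + 2) * ((n : ℝ) - 2) / 4)) := by
  have hn' : (3 : ℝ) ≤ n := by exact_mod_cast hn
  obtain ⟨R, hR, hΩR⟩ := hΩb.subset_ball_lt 0 0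
  obtain ⟨C, hC⟩ := (hζc.fderiv ℝ).exists_bound_of_continuous
    (hζs.continuous_fderiv (by simp))
  have hζd : Differentiable ℝ ζ := hζs.differentiable (by simp)
  set m : ℝ := ((n : ℝ) - 2) / 2 with hm_def
  have hm : 0 ≤ m := by rw [hm_def]; linarith
  set s : ℝ := β - 2 * m * k + 2 * (-(2 * m) - 1) with hs_def
  have hs : -(n : ℝ) < s := by
    rw [hs_def, hm_def]
    linarith
  set D : ℝ := C * R + 2 * m
  have hint : IntegrableOn (fun x : EuclideanSpace ℝ (Fin n) => ‖x‖ ^ s) Ω :=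
    (integrableOn_ball_norm_rpow (by omega) hR hs).mono_set hΩR
  have : Nonempty (Fin n) := ⟨⟨0, by omega⟩⟩
  refine IsBigO.of_bound (∫ x in Ω, D ^ 2 * ‖x‖ ^ s) ?_
  filter_upwards [self_mem_nhdsWithin] with ε hε
  replace hε : 0 < ε := hε
  set c : ℝ := ε ^ ((n - 2 : ℝ) / 4) with hc_def
  have hc : 0 < c := by positivity
  have hcpow : c ^ k * c ^ 2 = ε ^ ((k + 2) * ((n : ℝ) - 2) / 4) := by
    rw [← Real.rpow_natCast, ← Real.rpow_add hc, hc_def, ← Real.rpow_mul hε.le]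
    congr 1
    push_cast
    ring
  have hueq : u ε = fun y => c * ζ y * (ε + ‖y‖ ^ 2) ^ (-m) := by
    funext y
    rw [hu, hm_def, neg_div]
  rw [← hcpow, Real.norm_of_nonneg (by positivity : 0 ≤ c ^ k * c ^ 2), mul_comm,
    ← integral_const_mul]
  refine norm_integral_le_of_norm_le ((hint.const_mul _).const_mul _) ?_
  have hne : ∀ᵐ x : EuclideanSpace ℝ (Fin n), x ≠ 0 := by
    simp [ae_iff]
  filter_upwards [ae_restrict_of_ae hne, ae_restrict_mem hΩo.measurableSet] with x hx hxΩ
  have hx0 : 0 < ‖x‖ := norm_pos_iff.2 hx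
  have hxR : ‖x‖ ≤ R := (mem_ball_zero_iff.1 (hΩR hxΩ)).le
  have hgrad := norm_gradient_bubble_le hζd hx (hζ01 x) (hC x) hxR hc.le hε hm
  rw [← hueq] at hgrad
  have hζ0 := (hζ01 x).1
  have hu0 : 0 ≤ u ε x := by rw [hueq]; positivity
  have hux : u ε x ≤ c * ‖x‖ ^ (-(2 * m)) := by
    rw [hueq]
    calc c * ζ x * (ε + ‖x‖ ^ 2) ^ (-m) ≤ c * 1 * (‖x‖ ^ 2) ^ (-m) := by
          gcongr ?_ * ?_ * ?_
          · exact (hζ01 x).2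
          · exact Real.rpow_le_rpow_of_nonpos (by positivity) (by linarith) (by linarith)
      _ = c * ‖x‖ ^ (-(2 * m)) := by
          rw [mul_one, ← Real.rpow_natCast, ← Real.rpow_mul hx0.le]
          congr 2
          push_cast
          ring
  rw [Real.norm_of_nonneg (by positivity)]
  calc ‖x‖ ^ β * u ε x ^ k * ‖gradient (u ε) x‖ ^ 2
      ≤ ‖x‖ ^ β * (c * ‖x‖ ^ (-(2 * m))) ^ k * (c * (D * ‖x‖ ^ (-(2 * m) - 1))) ^ 2 := by
        gcongr
    _ = c ^ k * c ^ 2 * (D ^ 2 * ‖x‖ ^ s) := by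
        rw [Real.mul_rpow hc.le (by positivity), ← Real.rpow_mul hx0.le, mul_pow, mul_pow,
          ← Real.rpow_natCast (‖x‖ ^ (-(2 * m) - 1)) 2, ← Real.rpow_mul hx0.le]
        have : ‖x‖ ^ s = ‖x‖ ^ β * ‖x‖ ^ (-(2 * m) * k) * ‖x‖ ^ ((-(2 * m) - 1) * (2 : ℕ)) := by
          rw [← Real.rpow_add hx0, ← Real.rpow_add hx0, hs_def]
          congr 1
          push_cast
          ring
        rw [this]
        ring

end
end
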